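/- (Corollary 2.7, de Finetti reduction for IID-block-diagonal states with fixed marginal) Let n, dA, dB, kA, kB be positive natural numbers, let ΠA : Fin kA → Matrix (Fin dA) (Fin dA) ℂ and ΠB : Fin kB → Matrix (Fin dB) (Fin dB) ℂ be families of orthogonal projections (Hermitian idempotents, pairwise multiplying to 0), and let σ̂ be a positive semidefinite matrix indexed by Fin dA. Let ρ be a positive semidefinite, permutation-invariant matrix indexed by (Fin n → Fin dA × Fin dB) whose partial trace over the B-systems equals σ̂^⊗n, and which is IID-block-diagonal with respect to the family (ΠA i) ⊗ₖ (ΠB j), i.e. ρ = ∑_{f : Fin n → Fin kA × Fin kB} (⊗_t ((ΠA (f t).1) ⊗ₖ (ΠB (f t).2))) * ρ * (⊗_t ((ΠA (f t).1) ⊗ₖ (ΠB (f t).2))). Then there exists a probability measure μ on matrices indexed by Fin dA × Fin dB such that: μ-almost every σ is positive semidefinite, satisfies σ = ∑_{i,j} ((ΠA i) ⊗ₖ (ΠB j)) * σ * ((ΠA i) ⊗ₖ (ΠB j)), and has partial trace over Fin dB equal to σ̂; every entry of σ ↦ σ^⊗n is μ-integrable; and g_{n,x} • T − ρ is positive semidefinite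 with x = ∑_{i,j} ((ΠA i).rank)² * ((ΠB j).rank)², where T has entries T v w = ∫ (σ^⊗n) v w dμ(σ). -/

import Mathlib

open MeasureTheory
open scoped Kronecker ComplexOrder

noncomputable section

/-- `n`-fold tensor power of a matrix. -/
def tensorPow {d : Type*} [Fintype d] (σ : Matrix d d ℂ) (n : ℕ) :
    Matrix (Fin n → d) (Fin n → d) ℂ :=
  Matrix.of fun v w => ∏ i, σ (v i) (w i)

/-- Tensor product of a family of matrices. -/
def tensorFam {d : Type*} [Fintype d] {n : ℕ} (M : Fin n → Matrix d d ℂ) :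
    Matrix (Fin n → d) (Fin n → d) ℂ :=
  Matrix.of fun v w => ∏ t, M t (v t) (w t)

/-- Partial trace over the second factor of a product index type. -/
def ptrace {a r : Type*} [Fintype r] (M : Matrix (a × r) (a × r) ℂ) : Matrix a a ℂ :=
  Matrix.of fun x y => ∑ z : r, M (x, z) (y, z)

/-- Partial trace over the `r`-systems of a matrix on `n` copies of `a × r`. -/
def ptraceN {a r : Type*} [Fintype r] {n : ℕ}
    (M : Matrix (Fin n → a × r) (Fin n → a × r) ℂ) :
    Matrix (Fin n → a) (Fin n → a) ℂ :=
  Matrix.of fun u u' => ∑ z : Fin n → r, M (fun i => (u i, z i)) (fun i => (u' i, z i))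

/-- A matrix on `n` systems is permutation-invariant. -/
def PermInvariant {d : Type*} {n : ℕ} (ρ : Matrix (Fin n → d) (Fin n → d) ℂ) : Prop :=
  ∀ (π : Equiv.Perm (Fin n)) (v w : Fin n → d), ρ (v ∘ π) (w ∘ π) = ρ v w

/-- The measurable structure on complex matrices (the product σ-algebra on entries,
which coincides with the Borel σ-algebra). -/
instance matrixMeasurableSpace {m : Type*} : MeasurableSpace (Matrix m m ℂ) :=
  inferInstanceAs (MeasurableSpace (m → m → ℂ))

section BlockDiagonalDeFinetti

open Matrix

/-- A symmetric multilinear form vanishing on the diagonal at every unitary of the commutant of a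
self-adjoint family vanishes on that whole commutant. -/
theorem ContinuousMultilinearMap.eq_zero_of_unitary_diag {E ι κ : Type*} [NormedRing E]
    [NormedAlgebra ℂ E] [StarRing E] [ContinuousStar E] [CompleteSpace E] [StarModule ℂ E]
    [Fintype ι] [DecidableEq ι] (q : κ → E) (hq : ∀ k, star (q k) = q k)
    (c : ContinuousMultilinearMap ℂ (fun _ : ι => E) ℂ)
    (hsymm : ∀ (π : Equiv.Perm ι) (m : ι → E), c (m ∘ π) = c m)
    (hU : ∀ U ∈ unitary E, (∀ k, Commute (q k) U) → c (fun _ => U) = 0)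
    (m : ι → E) (hm : ∀ t k, Commute (q k) (m t)) : c m = 0 := by
  suffices H : ∀ (J : Finset ι) (m : ι → E), (∀ t k, Commute (q k) (m t)) →
      ∀ U ∈ unitary E, (∀ k, Commute (q k) U) → c (fun t => if t ∈ J then m t else U) = 0 by
    simpa using H Finset.univ m hm 1 (one_mem _) (fun k => Commute.one_right _)
  intro J
  induction J using Finset.induction_on with
  | empty => intro m _ U hU1 hU2; simpa using hU U hU1 hU2
  | insert j J hj ih =>
    intro m hm U hU1 hU2
    set x : ι → E := fun t => if t ∈ J then m t else U with hx
    have key : ∀ h : E, IsSelfAdjoint h → (∀ k, Commute (q k) h) →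
        c (Function.update x j (U * h)) = 0 := by
      intro h hh hqh
      let γ : ℝ → ι → E := fun s t => if t ∈ J then m t else
        U * NormedSpace.exp (s • (Complex.I • h))
      let γ' : ι → E := fun t => if t ∈ J then 0 else U * (Complex.I • h)
      have hγ0 : γ 0 = x := by
        funext t; simp [γ, hx]
      have hγ : HasDerivAt γ γ' 0 := by
        rw [hasDerivAt_pi]
        intro t
        by_cases ht : t ∈ J
        · simpa [γ, γ', ht] using hasDerivAt_const (0 : ℝ) (m t)
        · have := (hasDerivAt_exp_smul_const (𝕂 := ℝ) (Complex.I • h) (0 : ℝ)).const_mul U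
          simpa [γ, γ', ht] using this
      have hc : HasDerivAt (fun s => c (γ s)) (c.linearDeriv x γ') 0 := by
        have h1 := (c.hasFDerivAt x).restrictScalars ℝ
        rw [← hγ0] at h1
        have := h1.comp_hasDerivAt (0 : ℝ) hγ
        rw [hγ0] at this
        exact this
      have hz : (fun s => c (γ s)) = fun _ => 0 := by
        funext s
        refine ih m hm _ ?_ ?_
        · refine mul_mem hU1 ?_
          have hsa : IsSelfAdjoint (s • h) := by
            rw [isSelfAdjoint_iff, ← Complex.coe_smul, star_smul, hh.star_eq]; simp
          have := (selfAdjoint.expUnitary ⟨s • h, hsa⟩).2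
          simpa [selfAdjoint.expUnitary_coe, smul_comm s Complex.I h] using this
        · intro k
          refine (hU2 k).mul_right (Commute.exp_right ?_)
          exact ((hqh k).smul_right _).smul_right _
      rw [hz] at hc
      have h0 : c.linearDeriv x γ' = 0 := hc.unique (hasDerivAt_const _ _)
      rw [ContinuousMultilinearMap.linearDeriv_apply] at h0
      have hterm : ∀ i, c (Function.update x i (γ' i)) =
          if i ∈ J then 0 else c (Function.update x j (γ' j)) := by
        intro i
        split_ifs with hi
        · exact c.map_coord_zero i (by simp [γ', hi])
        · rw [← hsymm (Equiv.swap i j) (Function.update x j (γ' j))]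
          congr 1
          funext t
          rcases eq_or_ne t i with rfl | hti
          · simp [γ', hi, hj]
          · rcases eq_or_ne t j with rfl | htj
            · simp [hti, hti.symm, hx, hi, hj]
            · simp [hti, htj, Equiv.swap_apply_of_ne_of_ne]
      rw [Finset.sum_congr rfl (fun i _ => hterm i)] at h0
      have hγj : γ' j = Complex.I • (U * h) := by simp [γ', hj]
      rw [Finset.sum_ite, Finset.sum_const_zero, zero_add, Finset.sum_const, hγj,
        c.map_update_smul] at h0
      have hcard : (Finset.univ.filter (· ∉ J)).card ≠ 0 :=
        Finset.card_ne_zero_of_mem (a := j) (by simp [hj])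
      simpa [hcard] using h0
    have hlin : ∀ y : E, (∀ k, Commute (q k) y) → c (Function.update x j (U * y)) = 0 := by
      intro y hy
      have hys : ∀ k, Commute (q k) (star y) := fun k => by
        have := (hy k).star_star; rwa [hq k] at this
      have h1 := key (y + star y) (IsSelfAdjoint.add_star_self y)
        (fun k => (hy k).add_right (hys k))
      have h2 := key (Complex.I • (y - star y)) (by
          simp [IsSelfAdjoint, star_smul, smul_sub]; abel)
        (fun k => ((hy k).sub_right (hys k)).smul_right _)
      rw [mul_add, c.map_update_add] at h1
      rw [mul_smul_comm, mul_sub, c.map_update_smul, c.map_update_sub] at h2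
      have h3 := (smul_eq_zero.mp h2).resolve_left Complex.I_ne_zero
      have h4 : (2 : ℂ) * c (Function.update x j (U * y)) = 0 := by linear_combination h1 + h3
      simpa using h4
    have hUs : ∀ k, Commute (q k) (star U) := fun k => by
      have := (hU2 k).star_star; rwa [hq k] at this
    have := hlin (star U * m j) (fun k => (hUs k).mul_right (hm j k))
    rw [← mul_assoc, Unitary.mul_star_self_of_mem hU1, one_mul] at this
    rw [← this]
    congr 1
    funext t
    rcases eq_or_ne t j with rfl | htj
    · simp
    · simp [hx, htj]

theorem Matrix.IsHermitian.trace_re_le_rank {I : Type*} [Fintype I] [DecidableEq I]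
    {M : Matrix I I ℂ} (hM : M.IsHermitian) (h1 : (1 - M).PosSemidef) :
    M.trace.re ≤ M.rank := by
  have hle : ∀ i, hM.eigenvalues i ≤ 1 := by
    intro i
    have h := h1.re_dotProduct_nonneg (hM.eigenvectorBasis i)
    have hn : star (⇑(hM.eigenvectorBasis i)) ⬝ᵥ ⇑(hM.eigenvectorBasis i) = (1 : ℂ) := by
      have := hM.eigenvectorBasis.orthonormal.1 i
      have h2 : inner ℂ (hM.eigenvectorBasis i) (hM.eigenvectorBasis i) = (1 : ℂ) := by
        rw [inner_self_eq_norm_sq_to_K, this]; simp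
      rw [← h2, EuclideanSpace.inner_eq_star_dotProduct, dotProduct_comm]
    rw [sub_mulVec, one_mulVec, hM.mulVec_eigenvectorBasis, dotProduct_sub, dotProduct_smul,
      hn] at h
    simpa using h
  rw [hM.trace_eq_sum_eigenvalues, hM.rank_eq_card_non_zero_eigs, Fintype.card_subtype]
  simp only [Complex.re_sum]
  rw [Finset.card_eq_sum_ones, Nat.cast_sum, Finset.sum_filter]
  refine Finset.sum_le_sum fun i _ => ?_
  split_ifs with h
  · simpa using hle i
  · simp_all

theorem Matrix.PosSemidef.of_forall_pos {I : Type*} [Fintype I] 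
    (f : ℝ → Matrix I I ℂ) (hf : Continuous f) (h : ∀ ε > 0, (f ε).PosSemidef) :
    (f 0).PosSemidef := by
  have hcl : ∀ {p : Matrix I I ℂ → Prop}, IsClosed {M | p M} → (∀ ε > 0, p (f ε)) → p (f 0) := by
    intro p hp hpf
    have h0 : (0 : ℝ) ∈ closure (Set.Ioi 0) := by simp
    exact (hp.preimage hf).closure_subset_iff.2 hpf h0
  refine posSemidef_iff_dotProduct_mulVec.2 ⟨?_, fun x => ?_⟩
  · exact hcl (p := Matrix.IsHermitian) (isClosed_eq (by fun_prop) continuous_id)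
      fun ε hε => (h ε hε).1
  · exact hcl (p := fun M => 0 ≤ star x ⬝ᵥ M *ᵥ x)
      (isClosed_le continuous_const (by fun_prop)) fun ε hε => (h ε hε).dotProduct_mulVec_nonneg x

/-- Domination of a transformed rank-one matrix by a multiple of `T`, where `T` behaves like an
average of the rank-one matrix of `ξ` against its commutant. -/
theorem Matrix.PosSemidef.natCast_smul_sub_vecMulVec {I : Type*} [Fintype I] [DecidableEq I]
    {T L : Matrix I I ℂ} {ξ : I → ℂ} (hT : T.PosSemidef) (hTL : Commute T L)
    (hL : (Lᴴ * L) * (Lᴴ * L) = Lᴴ * L)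
    (hξ : ∀ Z, (∀ Y, Commute T Y → Commute Z Y) → star ξ ⬝ᵥ Z *ᵥ ξ = (Z * T).trace)
    {g : ℕ} (hg : T.rank ≤ g) :
    ((g : ℂ) • T - vecMulVec (L *ᵥ ξ) (star (L *ᵥ ξ))).PosSemidef := by
  set Ψ := L *ᵥ ξ with hΨ
  have key : ∀ ε > (0 : ℝ), (((g + ε : ℝ) : ℂ) • (T + (ε : ℂ) • 1)
      - vecMulVec Ψ (star Ψ)).PosSemidef := by
    intro ε hε
    have hεC : (0 : ℂ) < (ε : ℂ) := by exact_mod_cast hε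
    set N := T + (ε : ℂ) • (1 : Matrix I I ℂ) with hN
    have hNpd : N.PosDef := PosDef.posSemidef_add hT (PosDef.one.smul hεC)
    have hNu : IsUnit N.det := (isUnit_iff_isUnit_det N).1 hNpd.isUnit
    have hZc : ∀ Y, Commute T Y → Commute N⁻¹ Y := by
      intro Y hY
      have h1 : Commute N Y := hY.add_left ((Commute.one_left Y).smul_left _)
      change N⁻¹ * Y = Y * N⁻¹
      calc N⁻¹ * Y = N⁻¹ * (Y * N) * N⁻¹ := by
            rw [Matrix.mul_assoc, Matrix.mul_assoc, mul_nonsing_inv _ hNu, Matrix.mul_one]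
        _ = Y * N⁻¹ := by
            rw [← h1.eq, ← Matrix.mul_assoc, nonsing_inv_mul _ hNu, Matrix.one_mul]
    have hZT : N⁻¹ * T = 1 - (ε : ℂ) • N⁻¹ := by
      have : T = N - (ε : ℂ) • 1 := by simp [hN]
      rw [this, Matrix.mul_sub, nonsing_inv_mul _ hNu]
      simp
    have hZ := hNpd.inv
    have htr : (star ξ ⬝ᵥ N⁻¹ *ᵥ ξ).re ≤ g := by
      rw [hξ _ hZc]
      have hH : (N⁻¹ * T).IsHermitian := by
        rw [hZT]
        exact isHermitian_one.sub ((hZ.smul hεC).1)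
      refine (hH.trace_re_le_rank ?_).trans ?_
      · rw [hZT, sub_sub_cancel]; exact (hZ.smul hεC).posSemidef
      · exact_mod_cast (rank_mul_le_right _ _).trans hg
    have hTL' : Commute T Lᴴ := by
      have := hTL.star_star
      rwa [star_eq_conjTranspose, hT.1.eq] at this
    set q := Lᴴ * L with hq
    have hqH : qᴴ = q := by simp [hq]
    have hZq : Commute N⁻¹ q := hZc _ (hTL'.mul_right hTL)
    have hΨZ : star Ψ ⬝ᵥ N⁻¹ *ᵥ Ψ = star ξ ⬝ᵥ (N⁻¹ * q) *ᵥ ξ := by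
      rw [hΨ, star_mulVec, ← dotProduct_mulVec, mulVec_mulVec, mulVec_mulVec, Matrix.mul_assoc,
        (hZc _ hTL).eq, ← Matrix.mul_assoc, ← hq, hZq.eq]
    have hΨle : (star Ψ ⬝ᵥ N⁻¹ *ᵥ Ψ).re ≤ g := by
      refine le_trans ?_ htr
      rw [hΨZ, ← sub_nonneg, ← Complex.sub_re, ← dotProduct_sub, ← sub_mulVec]
      have h2 : N⁻¹ - N⁻¹ * q = (1 - q)ᴴ * N⁻¹ * (1 - q) := by
        rw [conjTranspose_sub, hqH, conjTranspose_one, Matrix.sub_mul, Matrix.one_mul, ← hZq.eq,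
          Matrix.mul_sub, Matrix.mul_one, Matrix.sub_mul, Matrix.mul_assoc N⁻¹ q q, hL]
        simp
      rw [h2]
      exact (hZ.posSemidef.conjTranspose_mul_mul_same (1 - q)).re_dotProduct_nonneg ξ
    have ha : (0 : ℝ) < g + ε := by positivity
    have haC : (0 : ℂ) < ((g + ε : ℝ) : ℂ) := by exact_mod_cast ha
    set B := replicateCol Unit Ψ with hB
    set D : Matrix Unit Unit ℂ := ((g + ε : ℝ) : ℂ) • 1 with hD
    have hDpd : D.PosDef := PosDef.one.smul haC
    let : Invertible N := hNpd.isUnit.invertible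
    let : Invertible D := hDpd.isUnit.invertible
    have hS : (D - Bᴴ * N⁻¹ * B).PosSemidef := by
      have : D - Bᴴ * N⁻¹ * B = diagonal fun _ => (((g + ε : ℝ) : ℂ) - star Ψ ⬝ᵥ N⁻¹ *ᵥ Ψ) := by
        ext i j
        rw [Matrix.mul_assoc]
        simp [hD, hB, Matrix.mul_apply, mulVec, dotProduct]
      rw [this]
      refine PosSemidef.diagonal fun _ => ?_
      have him : (star Ψ ⬝ᵥ N⁻¹ *ᵥ Ψ).im = 0 :=
        ((Complex.nonneg_iff.1 (hZ.posSemidef.dotProduct_mulVec_nonneg Ψ)).2).symm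
      rw [Pi.zero_apply, Complex.nonneg_iff]
      constructor
      · simp only [Complex.sub_re, Complex.ofReal_re]; linarith
      · simp [him]
    have h3 := (PosDef.fromBlocks₂₂ N B hDpd).1 ((PosDef.fromBlocks₁₁ B D hNpd).2 hS)
    have h4 := h3.smul haC.le
    have hDinv : D⁻¹ = (((g + ε : ℝ) : ℂ))⁻¹ • 1 := by
      refine inv_eq_right_inv ?_
      rw [hD, smul_mul_smul_comm, mul_inv_cancel₀ haC.ne']; simp
    have hsub : ((g + ε : ℝ) : ℂ) • (N - B * D⁻¹ * Bᴴ) =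
        ((g + ε : ℝ) : ℂ) • N - vecMulVec Ψ (star Ψ) := by
      rw [hDinv, smul_sub]
      congr 1
      rw [Matrix.mul_smul, Matrix.smul_mul, smul_smul, mul_inv_cancel₀ haC.ne']
      ext i j
      simp [hB, vecMulVec, Matrix.mul_apply]
    rwa [hsub] at h4
  have := PosSemidef.of_forall_pos (fun ε : ℝ => ((g + ε : ℝ) : ℂ) • (T + (ε : ℂ) • 1)
      - vecMulVec Ψ (star Ψ)) (by fun_prop) key
  simpa using this

section PiKronecker

variable {a b c : Type*} {n : ℕ}

/-- Tensor product of a family of rectangular matrices. -/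
def Matrix.piKronecker (M : Fin n → Matrix a b ℂ) : Matrix (Fin n → a) (Fin n → b) ℂ :=
  Matrix.of fun v w => ∏ t, M t (v t) (w t)

theorem tensorPow_eq_piKronecker [Fintype a] (M : Matrix a a ℂ) :
    tensorPow M n = piKronecker fun _ => M := rfl

theorem Matrix.piKronecker_mul [Fintype b] (M : Fin n → Matrix a b ℂ) (N : Fin n → Matrix b c ℂ) :
    piKronecker M * piKronecker N = piKronecker fun t => M t * N t := by
  ext v w
  simp only [piKronecker, Matrix.mul_apply, Matrix.of_apply, ← Finset.prod_mul_distrib]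
  rw [Finset.prod_univ_sum, Fintype.piFinset_univ]

theorem Matrix.piKronecker_conjTranspose (M : Fin n → Matrix a b ℂ) :
    (piKronecker M)ᴴ = piKronecker fun t => (M t)ᴴ := by
  ext v w
  simp [piKronecker]

theorem Matrix.piKronecker_transpose (M : Fin n → Matrix a b ℂ) :
    (piKronecker M)ᵀ = piKronecker fun t => (M t)ᵀ := rfl

theorem Matrix.piKronecker_one [DecidableEq a] :
    piKronecker (fun _ : Fin n => (1 : Matrix a a ℂ)) = 1 := by
  ext v w
  simp only [piKronecker, Matrix.of_apply, Matrix.one_apply, Finset.prod_ite_zero,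
    Finset.prod_const_one, funext_iff, Finset.mem_univ, true_implies]

theorem Matrix.piKronecker_sum {ι : Type*} [Fintype ι] (M : Fin n → ι → Matrix a b ℂ) :
    piKronecker (fun t => ∑ k, M t k) = ∑ f : Fin n → ι, piKronecker fun t => M t (f t) := by
  ext v w
  simp only [piKronecker, Matrix.of_apply, Matrix.sum_apply]
  rw [Finset.prod_univ_sum, Fintype.piFinset_univ]

theorem Matrix.piKronecker_eq_zero (M : Fin n → Matrix a b ℂ) (t : Fin n) (ht : M t = 0) :
    piKronecker M = 0 := by
  ext v w
  exact Finset.prod_eq_zero (Finset.mem_univ t) (by simp [ht])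

theorem Matrix.piKronecker_comp_perm (M : Fin n → Matrix a b ℂ) (π : Equiv.Perm (Fin n))
    (v : Fin n → a) (w : Fin n → b) :
    piKronecker (M ∘ π) (v ∘ π) (w ∘ π) = piKronecker M v w :=
  Equiv.prod_comp π fun t => M t (v t) (w t)

/-- Flatten a matrix with column systems `a` and row systems `b` to a vector on the joint
systems. -/
def Matrix.vecPi (X : Matrix (Fin n → b) (Fin n → a) ℂ) : (Fin n → a × b) → ℂ :=
  vec X ∘ Equiv.arrowProdEquivProdArrow (Fin n) (fun _ => a) (fun _ => b)

theorem Matrix.vecPi_apply (X : Matrix (Fin n → b) (Fin n → a) ℂ) (v : Fin n → a × b) :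
    vecPi X v = X (fun t => (v t).2) (fun t => (v t).1) := rfl

theorem Matrix.piKronecker_kronecker (P : Fin n → Matrix a a ℂ) (Q : Fin n → Matrix b b ℂ) :
    (piKronecker fun t => P t ⊗ₖ Q t) =
      (piKronecker P ⊗ₖ piKronecker Q).submatrix
        (Equiv.arrowProdEquivProdArrow (Fin n) (fun _ => a) (fun _ => b))
        (Equiv.arrowProdEquivProdArrow (Fin n) (fun _ => a) (fun _ => b)) := by
  ext v w
  simp [piKronecker, Finset.prod_mul_distrib, Equiv.arrowProdEquivProdArrow]

theorem Matrix.kronecker_submatrix_mulVec_vecPi [Fintype a] [Fintype b]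
    (P : Matrix (Fin n → a) (Fin n → a) ℂ)
    (Q : Matrix (Fin n → b) (Fin n → b) ℂ) (X : Matrix (Fin n → b) (Fin n → a) ℂ) :
    (P ⊗ₖ Q).submatrix
        (Equiv.arrowProdEquivProdArrow (Fin n) (fun _ => a) (fun _ => b))
        (Equiv.arrowProdEquivProdArrow (Fin n) (fun _ => a) (fun _ => b)) *ᵥ vecPi X =
      vecPi (Q * X * Pᵀ) := by
  rw [submatrix_mulVec_equiv, vecPi, vecPi, Function.comp_assoc, Equiv.self_comp_symm,
    Function.comp_id, kronecker_mulVec_vec]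

/-- The action of a matrix on the `b`-systems as a matrix on the joint systems. -/
def Matrix.actRight (a : Type*) [DecidableEq a] :
    Matrix (Fin n → b) (Fin n → b) ℂ →ₗ[ℂ] Matrix (Fin n → a × b) (Fin n → a × b) ℂ where
  toFun Y := ((1 : Matrix (Fin n → a) (Fin n → a) ℂ) ⊗ₖ Y).submatrix
    (Equiv.arrowProdEquivProdArrow (Fin n) (fun _ => a) (fun _ => b))
    (Equiv.arrowProdEquivProdArrow (Fin n) (fun _ => a) (fun _ => b))
  map_add' Y Z := by rw [kronecker_add]; rfl
  map_smul' c Y := by rw [kronecker_smul]; rfl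

variable [Fintype a] [Fintype b] [DecidableEq a]

theorem Matrix.actRight_mul (Y Z : Matrix (Fin n → b) (Fin n → b) ℂ) :
    actRight a (Y * Z) = actRight a Y * actRight a Z := by
  simp only [actRight, LinearMap.coe_mk, AddHom.coe_mk]
  rw [submatrix_mul_equiv, ← mul_kronecker_mul, Matrix.one_mul]

omit [Fintype a] [Fintype b] in
theorem Matrix.actRight_conjTranspose (Y : Matrix (Fin n → b) (Fin n → b) ℂ) :
    actRight a Yᴴ = (actRight a Y)ᴴ := by
  simp only [actRight, LinearMap.coe_mk, AddHom.coe_mk]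
  rw [conjTranspose_submatrix, conjTranspose_kronecker, conjTranspose_one]

omit [Fintype a] [Fintype b] in
theorem Matrix.actRight_one [DecidableEq b] :
    actRight a (1 : Matrix (Fin n → b) (Fin n → b) ℂ) = 1 := by
  simp only [actRight, LinearMap.coe_mk, AddHom.coe_mk]
  rw [one_kronecker_one, submatrix_one_equiv]

theorem Matrix.actRight_mulVec_vecPi (Y : Matrix (Fin n → b) (Fin n → b) ℂ)
    (X : Matrix (Fin n → b) (Fin n → a) ℂ) : actRight a Y *ᵥ vecPi X = vecPi (Y * X) := by
  simp only [actRight, LinearMap.coe_mk, AddHom.coe_mk]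
  rw [kronecker_submatrix_mulVec_vecPi, transpose_one, Matrix.mul_one]

end PiKronecker

/-- Rank factorization of a square matrix. -/
theorem Matrix.exists_mul_eq_of_rank {D : Type*} [Fintype D] (M : Matrix D D ℂ) :
    ∃ (u : Matrix D (Fin M.rank) ℂ) (u' : Matrix (Fin M.rank) D ℂ), M = u * u' := by
  classical
  let b : Module.Basis (Fin M.rank) ℂ (LinearMap.range M.mulVecLin) := Module.finBasis _ _
  refine ⟨of fun d k => (b k : D → ℂ) d,
    of fun k d => b.repr ⟨M *ᵥ Pi.single d 1, ⟨_, rfl⟩⟩ k, ?_⟩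
  ext d d'
  have h := congrArg (fun z : LinearMap.range M.mulVecLin => (z : D → ℂ) d)
    (b.sum_repr ⟨M *ᵥ Pi.single d' 1, ⟨_, rfl⟩⟩)
  simp only [Submodule.coe_sum, Submodule.coe_smul, Finset.sum_apply, Pi.smul_apply,
    smul_eq_mul, mulVec_single_one] at h
  simp only [Matrix.mul_apply, of_apply]
  rw [← col_apply M, ← h]
  exact Finset.sum_congr rfl fun k _ => by rw [mul_comm]; simp

/-- A matrix whose columns are symmetric tensors over the range of `P` has rank at most the
dimension of the symmetric power of that range. -/
theorem Matrix.rank_le_choose {D J : Type*} [Fintype D] [Fintype J] {n : ℕ} (P : Matrix D D ℂ)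
    (T : Matrix (Fin n → D) J ℂ)
    (hP : (piKronecker fun _ => P : Matrix (Fin n → D) (Fin n → D) ℂ) * T = T)
    (hperm : ∀ (π : Equiv.Perm (Fin n)) v j, T (v ∘ π) j = T v j) :
    T.rank ≤ (n + P.rank - 1).choose n := by
  classical
  obtain ⟨u, u', hu⟩ := P.exists_mul_eq_of_rank
  let pu : Matrix (Fin n → D) (Fin n → Fin P.rank) ℂ := piKronecker fun _ => u
  let pu' : Matrix (Fin n → Fin P.rank) (Fin n → D) ℂ := piKronecker fun _ => u'
  have hpu : pu * pu' = piKronecker fun _ => P := by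
    rw [piKronecker_mul, ← hu]
  set S : Matrix (Fin n → Fin P.rank) J ℂ := pu' * T with hS
  have hT : T = pu * S := by
    rw [hS, ← Matrix.mul_assoc, hpu, hP]
  have hSperm : ∀ (π : Equiv.Perm (Fin n)) v j, S (v ∘ π) j = S v j := by
    intro π v j
    simp only [hS, Matrix.mul_apply]
    rw [← (Equiv.arrowCongr π.symm (Equiv.refl D)).sum_comp]
    refine Finset.sum_congr rfl fun w _ => ?_
    have : (Equiv.arrowCongr π.symm (Equiv.refl D)) w = w ∘ π := by
      funext t; simp [Equiv.arrowCongr]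
    rw [this, hperm]
    congr 1
    exact piKronecker_comp_perm (fun _ => u') π v w
  let s : (Fin n → Fin P.rank) → Sym (Fin P.rank) n := fun v =>
    ⟨Multiset.map v Finset.univ.val, by simp⟩
  have hs : ∀ v w, s v = s w → ∀ j, S v j = S w j := by
    intro v w h j
    have h' : Multiset.map v Finset.univ.val = Multiset.map w Finset.univ.val :=
      congrArg Subtype.val h
    obtain ⟨π, hπ⟩ : ∃ π : Equiv.Perm (Fin n), v ∘ π = w := by
      have hc : ∀ k, Fintype.card {t // w t = k} = Fintype.card {t // v t = k} := by
        intro k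
        have := congrArg (Multiset.count k) h'
        rw [Multiset.count_map, Multiset.count_map] at this
        rw [Fintype.card_subtype, Fintype.card_subtype]
        simpa [Finset.card, eq_comm] using this.symm
      refine ⟨(Equiv.sigmaFiberEquiv w).symm.trans ((Equiv.sigmaCongrRight fun k =>
        Fintype.equivOfCardEq (hc k)).trans (Equiv.sigmaFiberEquiv v)), ?_⟩
      funext t
      simp only [Function.comp_apply, Equiv.trans_apply]
      have := ((Fintype.equivOfCardEq (hc (w t))) ⟨t, rfl⟩).2
      simpa [Equiv.sigmaFiberEquiv] using this
    rw [← hπ, hSperm]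
  let E : Matrix (Fin n → Fin P.rank) (Sym (Fin P.rank) n) ℂ := of fun v x =>
    if s v = x then 1 else 0
  let S' : Matrix (Sym (Fin P.rank) n) J ℂ := of fun x j =>
    if h : ∃ v, s v = x then S h.choose j else 0
  have hSE : S = E * S' := by
    ext v j
    have h : ∃ w, s w = s v := ⟨v, rfl⟩
    simp only [E, S', Matrix.mul_apply, of_apply, ite_mul, one_mul, zero_mul, Finset.sum_ite_eq,
      Finset.mem_univ, if_true]
    rw [dif_pos h]
    exact hs _ _ h.choose_spec.symm j
  rw [hT, hSE, ← Matrix.mul_assoc]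
  calc _ ≤ (pu * E).rank := rank_mul_le_left _ _
    _ ≤ Fintype.card (Sym (Fin P.rank) n) := rank_le_card_width _
    _ = _ := by rw [Sym.card_sym_eq_choose, Fintype.card_fin, add_comm]

section Commutant

variable {C κ : Type*} [Fintype C] [DecidableEq C] {n : ℕ}

/-- The tensor product of a family of matrices as a multilinear map. -/
def Matrix.piKroneckerMultilinear (C : Type*) (n : ℕ) :
    MultilinearMap ℂ (fun _ : Fin n => Matrix C C ℂ) (Matrix (Fin n → C) (Fin n → C) ℂ) :=
  MultilinearMap.pi fun v => MultilinearMap.pi fun w =>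
    (MultilinearMap.mkPiAlgebra ℂ (Fin n) ℂ).compLinearMap fun t =>
      Matrix.entryLinearMap ℂ ℂ (v t) (w t)

omit [Fintype C] [DecidableEq C] in
theorem Matrix.piKroneckerMultilinear_apply (M : Fin n → Matrix C C ℂ) :
    piKroneckerMultilinear C n M = piKronecker M := by
  ext v w
  rfl

open scoped Matrix.Norms.L2Operator in
theorem Matrix.sum_perm_piKronecker_eq_zero (Q : κ → Matrix C C ℂ) (hQ : ∀ k, (Q k).IsHermitian)
    (ℓ : Matrix (Fin n → C) (Fin n → C) ℂ →ₗ[ℂ] ℂ)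
    (hℓ : ∀ U ∈ unitary (Matrix C C ℂ), (∀ k, Commute (Q k) U) → ℓ (piKronecker fun _ => U) = 0)
    (m : Fin n → Matrix C C ℂ) (hm : ∀ t k, Commute (Q k) (m t)) :
    ∑ π : Equiv.Perm (Fin n), ℓ (piKronecker (m ∘ π)) = 0 := by
  let c : ContinuousMultilinearMap ℂ (fun _ : Fin n => Matrix C C ℂ) ℂ :=
    { ∑ π : Equiv.Perm (Fin n),
        (ℓ.compMultilinearMap (piKroneckerMultilinear C n)).domDomCongr π with
      cont := by
        have hpi : Continuous fun M : Fin n → Matrix C C ℂ => piKronecker M :=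
          continuous_matrix fun v w => by
            simp only [piKronecker, of_apply]
            exact continuous_finsetProd _ fun t _ => (continuous_apply t).matrix_elem (v t) (w t)
        change Continuous fun m : Fin n → Matrix C C ℂ => (∑ π : Equiv.Perm (Fin n),
          (ℓ.compMultilinearMap (piKroneckerMultilinear C n)).domDomCongr π) m
        simp only [_root_.sum_apply]
        refine continuous_finsetSum _ fun π _ => ?_
        change Continuous fun m : Fin n → Matrix C C ℂ =>
          ℓ (piKroneckerMultilinear C n fun i => m (π i))
        simp only [piKroneckerMultilinear_apply]
        exact (LinearMap.continuous_of_finiteDimensional ℓ).comp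
          (hpi.comp (continuous_pi fun i => continuous_apply (π i))) }
  have hc : ∀ m, c m = ∑ π : Equiv.Perm (Fin n), ℓ (piKronecker (m ∘ π)) := by
    intro m
    change (∑ π : Equiv.Perm (Fin n), (ℓ.compMultilinearMap
      (piKroneckerMultilinear C n)).domDomCongr π) m = _
    rw [_root_.sum_apply]
    exact Finset.sum_congr rfl fun π _ => congrArg ℓ (piKroneckerMultilinear_apply _)
  rw [← hc]
  refine c.eq_zero_of_unitary_diag Q (fun k => hQ k) ?_ ?_ m hm
  · intro π m
    rw [hc, hc]
    exact Fintype.sum_equiv (Equiv.mulLeft π) _ _ fun τ => rfl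
  · intro U hU hQU
    rw [hc]
    exact Finset.sum_eq_zero fun π _ => hℓ U hU hQU

theorem Matrix.commute_actRight_sum_smul {a J : Type*} [Fintype a] [DecidableEq a] [Fintype J]
    (Q : κ → Matrix C C ℂ) (hQ : ∀ k, (Q k).IsHermitian)
    (T : Matrix (Fin n → a × C) (Fin n → a × C) ℂ)
    (hT : ∀ U ∈ unitary (Matrix C C ℂ), (∀ k, Commute (Q k) U) →
      Commute T (actRight a (piKronecker fun _ => U)))
    (m : J → Matrix C C ℂ) (hm : ∀ j k, Commute (Q k) (m j))
    (ψ : (Fin n → J) → ℂ) (hψ : ∀ (π : Equiv.Perm (Fin n)) v, ψ (v ∘ π) = ψ v) :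
    Commute T (actRight a (∑ v, ψ v • piKronecker fun t => m (v t))) := by
  rw [commute_iff_eq, ← sub_eq_zero]
  ext x y
  let ℓ : Matrix (Fin n → C) (Fin n → C) ℂ →ₗ[ℂ] ℂ :=
    (Matrix.entryLinearMap ℂ ℂ x y) ∘ₗ
      (LinearMap.mulLeft ℂ T - LinearMap.mulRight ℂ T) ∘ₗ actRight a
  have hℓ : ∀ Y, ℓ Y = (T * actRight a Y - actRight a Y * T) x y := fun Y => rfl
  rw [← hℓ, Matrix.zero_apply]
  have h0 : ∀ v : Fin n → J, ∑ π : Equiv.Perm (Fin n), ℓ (piKronecker fun t => m ((v ∘ π) t)) = 0 :=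
    fun v => sum_perm_piKronecker_eq_zero Q hQ ℓ
      (fun U hU hQU => by rw [hℓ, (hT U hU hQU).eq, sub_self, Matrix.zero_apply])
      (fun t => m (v t)) (fun t k => hm _ _)
  have h1 : ∀ π : Equiv.Perm (Fin n),
      ∑ v : Fin n → J, ψ v * ℓ (piKronecker fun t => m ((v ∘ π) t)) =
      ∑ v : Fin n → J, ψ v * ℓ (piKronecker fun t => m (v t)) := by
    intro π
    refine Fintype.sum_equiv (Equiv.arrowCongr π.symm (Equiv.refl J)) _ _ fun v => ?_
    have : (Equiv.arrowCongr π.symm (Equiv.refl J)) v = v ∘ π := by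
      funext t; simp [Equiv.arrowCongr]
    rw [this, hψ]
  have h2 : (Fintype.card (Equiv.Perm (Fin n)) : ℂ) *
      ∑ v : Fin n → J, ψ v * ℓ (piKronecker fun t => m (v t)) = 0 := by
    rw [← nsmul_eq_mul, ← Finset.card_univ, ← Finset.sum_const,
      ← Finset.sum_congr rfl fun π _ => h1 π, Finset.sum_comm]
    refine Finset.sum_eq_zero fun v _ => ?_
    rw [← Finset.mul_sum, h0, mul_zero]
  rw [map_sum]
  simp only [map_smul, smul_eq_mul]
  exact (mul_eq_zero.mp h2).resolve_left (by exact_mod_cast Fintype.card_ne_zero)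

end Commutant

section Haar

variable {C κ : Type*} [Fintype C] [DecidableEq C]

instance matrixBorelSpace {m : Type*} [Finite m] : BorelSpace (Matrix m m ℂ) :=
  inferInstanceAs (BorelSpace (m → m → ℂ))

/-- The unitary matrices commuting with every member of a family. -/
def Matrix.unitaryCommutant (Q : κ → Matrix C C ℂ) : Subgroup (unitary (Matrix C C ℂ)) where
  carrier := {U | ∀ k, Commute (Q k) (U : Matrix C C ℂ)}
  mul_mem' hU hV k := (hU k).mul_right (hV k)
  one_mem' k := Commute.one_right _
  inv_mem' {U} hU k := by
    have h := congrArg (fun Y => star (U : Matrix C C ℂ) * Y * star (U : Matrix C C ℂ)) (hU k).eq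
    simp only [mul_assoc, Unitary.mul_star_self_of_mem U.2, mul_one] at h
    rw [← mul_assoc (star (U : Matrix C C ℂ)) (U : Matrix C C ℂ),
      Unitary.star_mul_self_of_mem U.2, one_mul] at h
    exact h.symm

theorem Matrix.isCompact_setOf_unitary_commute (Q : κ → Matrix C C ℂ) :
    IsCompact {U : Matrix C C ℂ | U ∈ unitary (Matrix C C ℂ) ∧ ∀ k, Commute (Q k) U} := by
  have hK : IsCompact (Set.univ.pi fun _ : C => Set.univ.pi fun _ : C =>
      Metric.closedBall (0 : ℂ) 1) :=
    isCompact_univ_pi fun _ => isCompact_univ_pi fun _ => isCompact_closedBall 0 1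
  refine IsCompact.of_isClosed_subset (X := Matrix C C ℂ) hK ?_ ?_
  · have h : IsClosed (⋂ k, {U : Matrix C C ℂ | Q k * U = U * Q k}) :=
      isClosed_iInter fun k => isClosed_eq (by fun_prop) (by fun_prop)
    convert (isClosed_unitary (R := Matrix C C ℂ)).inter h using 1
    ext U
    simp [Commute, SemiconjBy]
  · intro U hU i _ j _
    simpa using entry_norm_bound_of_unitary hU.1 i j

instance Matrix.compactSpace_unitaryCommutant (Q : κ → Matrix C C ℂ) :
    CompactSpace (unitaryCommutant Q) := by
  have hi : Topology.IsInducing fun U : unitaryCommutant Q => (U : Matrix C C ℂ) :=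
    Topology.IsInducing.subtypeVal.comp Topology.IsInducing.subtypeVal
  rw [← isCompact_univ_iff, hi.isCompact_iff]
  convert isCompact_setOf_unitary_commute Q
  ext U
  constructor
  · rintro ⟨V, -, rfl⟩
    exact ⟨V.1.2, V.2⟩
  · intro hU
    exact ⟨⟨⟨U, hU.1⟩, hU.2⟩, trivial, rfl⟩

theorem Matrix.exists_invariant_measure (Q : κ → Matrix C C ℂ) :
    ∃ ν : Measure (Matrix C C ℂ), IsProbabilityMeasure ν ∧
      (∀ᵐ U ∂ν, U ∈ unitary (Matrix C C ℂ) ∧ ∀ k, Commute (Q k) U) ∧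
      ∀ V ∈ unitary (Matrix C C ℂ), (∀ k, Commute (Q k) V) → ν.map (fun U => V * U) = ν := by
  let G := unitaryCommutant Q
  let _ : MeasurableSpace G := borel G
  have _ : BorelSpace G := ⟨rfl⟩
  let h : Measure G := Measure.haarMeasure ⊤
  let i : G → Matrix C C ℂ := fun U => (U : Matrix C C ℂ)
  have hic : Continuous i := continuous_subtype_val.comp continuous_subtype_val
  have hi : Measurable i := hic.measurable
  have hp : IsProbabilityMeasure h := ⟨by
    simpa using Measure.haarMeasure_self (G := G) (K₀ := ⊤)⟩
  refine ⟨h.map i, Measure.isProbabilityMeasure_map hi.aemeasurable, ?_, ?_⟩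
  · rw [ae_map_iff hi.aemeasurable (isCompact_setOf_unitary_commute Q).isClosed.measurableSet]
    exact Filter.Eventually.of_forall fun U => ⟨U.1.2, U.2⟩
  · intro V hV hQV
    let V' : G := ⟨⟨V, hV⟩, hQV⟩
    have hm : Measurable fun U : Matrix C C ℂ => V * U :=
      (continuous_const.matrix_mul continuous_id).measurable
    rw [Measure.map_map hm hi]
    have : (fun U => V * U) ∘ i = i ∘ fun U => V' * U := rfl
    rw [this, ← Measure.map_map hi (measurable_const_mul V'), map_mul_left_eq_self]

theorem MeasureTheory.Measure.integrable_of_ae_unitary {ν : Measure (Matrix C C ℂ)}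
    [IsProbabilityMeasure ν] (hν : ∀ᵐ U ∂ν, U ∈ unitary (Matrix C C ℂ))
    {f : Matrix C C ℂ → ℂ} (hf : Continuous f) : Integrable f ν := by
  have hK : IsCompact {U : Matrix C C ℂ | U ∈ unitary (Matrix C C ℂ)} := by
    simpa using isCompact_setOf_unitary_commute (fun k : Empty => (k.elim : Matrix C C ℂ))
  rw [← Measure.restrict_eq_self_of_ae_mem hν]
  exact hf.continuousOn.integrableOn_compact hK

end Haar

section Twirl

variable {Ω I : Type*} [MeasurableSpace Ω] {ν : Measure Ω} [Fintype I]

/-- The average of the rank-one matrices of a random vector. -/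
def MeasureTheory.Measure.secondMoment (ν : Measure Ω) (ξ : Ω → I → ℂ) : Matrix I I ℂ :=
  Matrix.of fun x y => ∫ ω, vecMulVec (ξ ω) (star (ξ ω)) x y ∂ν

theorem MeasureTheory.Measure.map_secondMoment [DecidableEq I] {ξ : Ω → I → ℂ}
    (hξ : ∀ x y, Integrable (fun ω => vecMulVec (ξ ω) (star (ξ ω)) x y) ν)
    (φ : Matrix I I ℂ →ₗ[ℂ] ℂ) :
    φ (ν.secondMoment ξ) = ∫ ω, φ (vecMulVec (ξ ω) (star (ξ ω))) ∂ν := by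
  have h : ∀ M : Matrix I I ℂ, φ M = ∑ x, ∑ y, M x y * φ (single x y 1) := by
    intro M
    have hM : M = ∑ x, ∑ y, single x y (M x y) := matrix_eq_sum_single M
    refine (congrArg φ hM).trans ?_
    rw [_root_.map_sum]
    simp_rw [_root_.map_sum]
    refine Finset.sum_congr rfl fun x _ => Finset.sum_congr rfl fun y _ => ?_
    rw [← smul_eq_mul, ← map_smul, smul_single, smul_eq_mul, mul_one]
  rw [h]
  simp only [h (vecMulVec _ _)]
  rw [integral_finsetSum _ fun x _ => integrable_finsetSum _ fun y _ => (hξ x y).mul_const _]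
  refine Finset.sum_congr rfl fun x _ => ?_
  rw [integral_finsetSum _ fun y _ => (hξ x y).mul_const _]
  refine Finset.sum_congr rfl fun y _ => ?_
  rw [integral_mul_const]
  rfl

theorem MeasureTheory.Measure.trace_mul_secondMoment [DecidableEq I] {ξ : Ω → I → ℂ}
    (hξ : ∀ x y, Integrable (fun ω => vecMulVec (ξ ω) (star (ξ ω)) x y) ν)
    (Z : Matrix I I ℂ) :
    (Z * ν.secondMoment ξ).trace = ∫ ω, star (ξ ω) ⬝ᵥ Z *ᵥ ξ ω ∂ν := by
  have := map_secondMoment hξ (traceLinearMap I ℂ ℂ ∘ₗ LinearMap.mulLeft ℂ Z)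
  simp only [LinearMap.comp_apply, traceLinearMap_apply, LinearMap.mulLeft_apply] at this
  rw [this]
  refine integral_congr_ae (Filter.Eventually.of_forall fun ω => ?_)
  simp only [mul_vecMulVec, trace_vecMulVec, dotProduct_comm]

theorem MeasureTheory.Measure.posSemidef_secondMoment [DecidableEq I] {ξ : Ω → I → ℂ}
    (hξ : ∀ x y, Integrable (fun ω => vecMulVec (ξ ω) (star (ξ ω)) x y) ν) :
    (ν.secondMoment ξ).PosSemidef := by
  refine PosSemidef.of_dotProduct_mulVec_nonneg ?_ fun z => ?_
  · ext x y
    simp only [secondMoment, conjTranspose_apply, of_apply]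
    rw [RCLike.star_def, ← integral_conj]
    simp [vecMulVec_apply, mul_comm]
  · have h : star z ⬝ᵥ ν.secondMoment ξ *ᵥ z =
        (vecMulVec z (star z) * ν.secondMoment ξ).trace := by
      rw [vecMulVec_mul, trace_vecMulVec, dotProduct_mulVec, dotProduct_comm]
    rw [h, trace_mul_secondMoment hξ]
    have h2 : ∀ ω, star (ξ ω) ⬝ᵥ vecMulVec z (star z) *ᵥ ξ ω =
        ((Complex.normSq (star z ⬝ᵥ ξ ω) : ℝ) : ℂ) := by
      intro ω
      rw [vecMulVec_mulVec, ← Complex.mul_conj]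
      rw [← Complex.star_def, ← star_dotProduct_star, star_star]
      simp
    simp only [h2]
    rw [integral_complex_ofReal]
    exact_mod_cast integral_nonneg fun ω => Complex.normSq_nonneg _

theorem MeasureTheory.Measure.mul_secondMoment_mul [DecidableEq I] {ξ : Ω → I → ℂ}
    (hξ : ∀ x y, Integrable (fun ω => vecMulVec (ξ ω) (star (ξ ω)) x y) ν)
    (L : Matrix I I ℂ) :
    L * ν.secondMoment ξ * Lᴴ = ν.secondMoment fun ω => L *ᵥ ξ ω := by
  ext x y
  have := map_secondMoment hξ (Matrix.entryLinearMap ℂ ℂ x y ∘ₗ LinearMap.mulRight ℂ Lᴴ ∘ₗ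
    LinearMap.mulLeft ℂ L)
  simp only [LinearMap.comp_apply, LinearMap.mulLeft_apply, LinearMap.mulRight_apply,
    entryLinearMap_apply] at this
  rw [this]
  simp only [mul_vecMulVec, vecMulVec_mul, secondMoment, of_apply, star_mulVec]

end Twirl

section Orbit

variable {C κ a : Type*} [Fintype C] [DecidableEq C] [Fintype a] [DecidableEq a]
  {n : ℕ}

/-- The orbit of a tensor power vector under right tensor power matrices. -/
def Matrix.powVec (n : ℕ) (X : Matrix C a ℂ) : (Fin n → a × C) → ℂ :=
  vecPi (piKronecker fun _ => X)

omit [Fintype C] [DecidableEq C] [Fintype a] [DecidableEq a] in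
theorem Matrix.powVec_comp_perm (X : Matrix C a ℂ) (π : Equiv.Perm (Fin n)) (v : Fin n → a × C) :
    powVec n X (v ∘ π) = powVec n X v :=
  piKronecker_comp_perm (fun _ => X) π (fun t => (v t).2) (fun t => (v t).1)

omit [DecidableEq C] in
theorem Matrix.powVec_mul (V : Matrix C C ℂ) (X : Matrix C a ℂ) :
    powVec n (V * X) = actRight a (piKronecker fun _ => V) *ᵥ powVec n X := by
  rw [powVec, powVec, actRight_mulVec_vecPi, piKronecker_mul]

omit [DecidableEq C] [Fintype a] [DecidableEq a] in
theorem Matrix.continuous_powVec (X : Matrix C a ℂ) (v : Fin n → a × C) :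
    Continuous fun U : Matrix C C ℂ => powVec n (U * X) v := by
  simp only [powVec, vecPi_apply, piKronecker, of_apply]
  exact continuous_finsetProd _ fun t _ =>
    (continuous_id.matrix_mul continuous_const).matrix_elem _ _

/-- The average of the orbit of `powVec n X` under random `U`. -/
def Matrix.orbitAverage (n : ℕ) (ν : Measure (Matrix C C ℂ)) (X : Matrix C a ℂ) :
    Matrix (Fin n → a × C) (Fin n → a × C) ℂ :=
  ν.secondMoment fun U => powVec n (U * X)

variable {ν : Measure (Matrix C C ℂ)} [IsProbabilityMeasure ν] {Q : κ → Matrix C C ℂ}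

omit [Fintype a] [DecidableEq a] in
theorem Matrix.integrable_vecMulVec_powVec
    (hae : ∀ᵐ U ∂ν, U ∈ unitary (Matrix C C ℂ) ∧ ∀ k, Commute (Q k) U)
    (X : Matrix C a ℂ) (v w : Fin n → a × C) :
    Integrable (fun U => vecMulVec (powVec n (U * X)) (star (powVec n (U * X))) v w) ν := by
  refine Measure.integrable_of_ae_unitary (hae.mono fun U hU => hU.1) ?_
  simp only [vecMulVec_apply, Pi.star_apply]
  exact (continuous_powVec X v).mul (continuous_star.comp (continuous_powVec X w))

theorem Matrix.mem_unitary_actRight {V : Matrix C C ℂ} (hV : V ∈ unitary (Matrix C C ℂ)) :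
    (actRight a (piKronecker fun _ : Fin n => V))ᴴ *
      actRight a (piKronecker fun _ : Fin n => V) = 1 := by
  rw [← actRight_conjTranspose, ← actRight_mul, piKronecker_conjTranspose, piKronecker_mul,
    ← star_eq_conjTranspose, Unitary.star_mul_self_of_mem hV, piKronecker_one, actRight_one]

theorem Matrix.commute_orbitAverage
    (hae : ∀ᵐ U ∂ν, U ∈ unitary (Matrix C C ℂ) ∧ ∀ k, Commute (Q k) U)
    (hinv : ∀ V ∈ unitary (Matrix C C ℂ), (∀ k, Commute (Q k) V) →
      ν.map (fun U => V * U) = ν)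
    (X : Matrix C a ℂ) (V : Matrix C C ℂ) (hV : V ∈ unitary (Matrix C C ℂ))
    (hQV : ∀ k, Commute (Q k) V) :
    Commute (orbitAverage n ν X) (actRight a (piKronecker fun _ => V)) := by
  have h : actRight a (piKronecker fun _ => V) * orbitAverage n ν X *
      (actRight a (piKronecker fun _ => V))ᴴ = orbitAverage n ν X := by
    rw [orbitAverage, Measure.mul_secondMoment_mul (integrable_vecMulVec_powVec hae X)]
    ext v w
    simp only [Measure.secondMoment, of_apply, ← powVec_mul, ← Matrix.mul_assoc]
    conv_rhs => rw [← hinv V hV hQV]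
    rw [integral_map]
    · exact (continuous_const.matrix_mul continuous_id).measurable.aemeasurable
    · rw [hinv V hV hQV]
      exact (integrable_vecMulVec_powVec hae X v w).aestronglyMeasurable
  have h' := congrArg (· * actRight a (piKronecker fun _ : Fin n => V)) h
  simp only [Matrix.mul_assoc, mem_unitary_actRight hV, Matrix.mul_one] at h'
  exact h'.symm

theorem Matrix.dotProduct_powVec_eq_trace
    (hae : ∀ᵐ U ∂ν, U ∈ unitary (Matrix C C ℂ) ∧ ∀ k, Commute (Q k) U)
    (hinv : ∀ V ∈ unitary (Matrix C C ℂ), (∀ k, Commute (Q k) V) →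
      ν.map (fun U => V * U) = ν)
    (X : Matrix C a ℂ) (Z : Matrix (Fin n → a × C) (Fin n → a × C) ℂ)
    (hZ : ∀ Y, Commute (orbitAverage n ν X) Y → Commute Z Y) :
    star (powVec n X) ⬝ᵥ Z *ᵥ powVec n X = (Z * orbitAverage n ν X).trace := by
  rw [orbitAverage, Measure.trace_mul_secondMoment (integrable_vecMulVec_powVec hae X)]
  rw [integral_congr_ae (g := fun _ => star (powVec n X) ⬝ᵥ Z *ᵥ powVec n X)]
  · simp
  · filter_upwards [hae] with U hU
    have hc := hZ _ (commute_orbitAverage hae hinv X U hU.1 hU.2)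
    rw [powVec_mul, star_mulVec, mulVec_mulVec, hc.eq, ← mulVec_mulVec, dotProduct_mulVec,
      vecMul_vecMul, mem_unitary_actRight hU.1, vecMul_one]

theorem Matrix.rank_orbitAverage_le
    (hae : ∀ᵐ U ∂ν, U ∈ unitary (Matrix C C ℂ) ∧ ∀ k, Commute (Q k) U)
    (X : Matrix C a ℂ) (P : Matrix (a × C) (a × C) ℂ)
    (hP : ∀ U, (∀ k, Commute (Q k) U) →
      (piKronecker fun _ => P : Matrix (Fin n → a × C) (Fin n → a × C) ℂ) *ᵥ powVec n (U * X) =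
        powVec n (U * X)) :
    (orbitAverage n ν X).rank ≤ (n + P.rank - 1).choose n := by
  refine rank_le_choose P _ ?_ ?_
  · ext v w
    have := Measure.map_secondMoment (integrable_vecMulVec_powVec hae X)
      (Matrix.entryLinearMap ℂ ℂ v w ∘ₗ LinearMap.mulLeft ℂ
        (piKronecker fun _ => P : Matrix (Fin n → a × C) (Fin n → a × C) ℂ))
    simp only [LinearMap.comp_apply, LinearMap.mulLeft_apply, entryLinearMap_apply] at this
    rw [orbitAverage, this]
    refine integral_congr_ae ?_
    filter_upwards [hae] with U hU
    simp only [mul_vecMulVec, hP U hU.2]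
  · intro π v w
    simp only [orbitAverage, Measure.secondMoment, of_apply, vecMulVec_apply, powVec_comp_perm]

end Orbit

/-- A Hermitian matrix has a Hermitian inner inverse in its bicommutant. -/
theorem Matrix.IsHermitian.exists_inner_inverse {a : Type*} [Fintype a] [DecidableEq a]
    {s : Matrix a a ℂ} (hs : s.IsHermitian) :
    ∃ S : Matrix a a ℂ, S.IsHermitian ∧ s * S * s = s ∧ ∀ p, Commute s p → Commute S p := by
  have hs' : IsSelfAdjoint s := hs
  have hc : ContinuousOn (fun x : ℝ => x⁻¹) (spectrum ℝ s) :=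
    (Matrix.finite_real_spectrum (A := s)).continuousOn _
  refine ⟨cfc (fun x : ℝ => x⁻¹) s, cfc_predicate _ s, ?_, fun p hp => ?_⟩
  · conv_lhs => enter [1, 1]; rw [← cfc_id ℝ s]
    conv_lhs => enter [2]; rw [← cfc_id ℝ s]
    rw [← cfc_mul _ _ s, ← cfc_mul _ _ s]
    conv_rhs => rw [← cfc_id ℝ s]
    refine cfc_congr fun x _ => ?_
    simp
  · exact hp.cfc_real _

section Blocks

variable {a C κ : Type*} [Fintype a] [DecidableEq a] [Fintype C] [DecidableEq C] [Fintype κ]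
  {n : ℕ} {p : κ → Matrix a a ℂ} {Q : κ → Matrix C C ℂ}

omit [DecidableEq a] [DecidableEq C] in
theorem Matrix.piKronecker_sum_kronecker_mulVec_vecPi
    (X : Matrix (Fin n → C) (Fin n → a) ℂ) :
    (piKronecker fun _ => ∑ k, (p k)ᵀ ⊗ₖ Q k : Matrix (Fin n → a × C) (Fin n → a × C) ℂ) *ᵥ
        vecPi X =
      vecPi (∑ f : Fin n → κ,
        piKronecker (fun t => Q (f t)) * X * piKronecker fun t => p (f t)) := by
  have h : ∀ (F : (Fin n → κ) → Matrix (Fin n → C) (Fin n → a) ℂ),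
      vecPi (∑ f, F f) = ∑ f, vecPi (F f) := by
    intro F
    ext v
    simp [vecPi_apply, Matrix.sum_apply]
  rw [piKronecker_sum, h, sum_mulVec]
  refine Finset.sum_congr rfl fun f _ => ?_
  rw [piKronecker_kronecker, kronecker_submatrix_mulVec_vecPi]
  rfl

omit [DecidableEq a] [DecidableEq C] in
theorem Matrix.mul_eq_mul_of_eq_sum (hQ : ∀ k, Q k * Q k = Q k)
    (hQQ : ∀ j k, j ≠ k → Q j * Q k = 0) (hp : ∀ k, p k * p k = p k)
    (hpp : ∀ j k, j ≠ k → p j * p k = 0) {X : Matrix C a ℂ} (hX : X = ∑ k, Q k * X * p k) (k : κ) :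
    Q k * X = X * p k := by
  have h1 : Q k * X = Q k * X * p k := by
    conv_lhs => rw [hX]
    rw [Matrix.mul_sum, Finset.sum_eq_single k]
    · simp only [← Matrix.mul_assoc, hQ]
    · intro j _ hj
      simp only [← Matrix.mul_assoc, hQQ k j hj.symm, Matrix.zero_mul]
    · simp
  have h2 : X * p k = Q k * X * p k := by
    conv_lhs => rw [hX]
    rw [Matrix.sum_mul, Finset.sum_eq_single k]
    · simp only [Matrix.mul_assoc, hp]
    · intro j _ hj
      simp only [Matrix.mul_assoc, hpp j k hj, Matrix.mul_zero]
    · simp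
  rw [h1, h2]

omit [DecidableEq a] [DecidableEq C] in
theorem Matrix.piKronecker_sum_kronecker_mulVec_powVec {X : Matrix C a ℂ}
    (hX : X = ∑ k, Q k * X * p k) :
    (piKronecker fun _ => ∑ k, (p k)ᵀ ⊗ₖ Q k : Matrix (Fin n → a × C) (Fin n → a × C) ℂ) *ᵥ
        powVec n X = powVec n X := by
  conv_rhs => rw [powVec, hX, piKronecker_sum]
  simp only [powVec, piKronecker_sum_kronecker_mulVec_vecPi, piKronecker_mul]

omit [DecidableEq a] [DecidableEq C] in
theorem Matrix.eq_sum_mul_of_commute {U : Matrix C C ℂ} (hU : ∀ k, Commute (Q k) U)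
    {X : Matrix C a ℂ} (hX : X = ∑ k, Q k * X * p k) : U * X = ∑ k, Q k * (U * X) * p k := by
  conv_lhs => rw [hX]
  rw [Matrix.mul_sum]
  refine Finset.sum_congr rfl fun k _ => ?_
  rw [← Matrix.mul_assoc, ← Matrix.mul_assoc, ← (hU k).eq, Matrix.mul_assoc (Q k)]

omit [Fintype κ] in
theorem Matrix.eq_sum_smul_piKronecker_single (Y : Matrix (Fin n → C) (Fin n → a) ℂ) :
    Y = ∑ v : Fin n → a × C,
      vecPi Y v • piKronecker fun t => single (v t).2 (v t).1 (1 : ℂ) := by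
  ext c w
  simp only [Matrix.sum_apply, Matrix.smul_apply, piKronecker, of_apply, single_apply,
    Finset.prod_ite_zero, Finset.prod_const_one, smul_eq_mul, mul_ite, mul_one, mul_zero]
  rw [Finset.sum_eq_single fun t => (w t, c t)]
  · simp [vecPi_apply]
  · intro v _ hv
    rw [if_neg]
    intro h
    exact hv (funext fun t => Prod.ext (h t (Finset.mem_univ t)).2 (h t (Finset.mem_univ t)).1)
  · simp

theorem Matrix.mul_piKronecker_eq_sum {Y : Matrix (Fin n → C) (Fin n → a) ℂ}
    (hY : Y = ∑ f : Fin n → κ, piKronecker (fun t => Q (f t)) * Y * piKronecker fun t => p (f t))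
    {R : Matrix (Fin n → a) (Fin n → C) ℂ} {r : Matrix a C ℂ} (hR : R = piKronecker fun _ => r) :
    Y * R =
      ∑ v : Fin n → a × C, vecPi Y v • piKronecker fun t =>
        ∑ k, Q k * single (v t).2 (v t).1 (1 : ℂ) * p k * r := by
  have hsum : ∀ v : Fin n → a × C, (piKronecker fun t =>
      ∑ k, Q k * single (v t).2 (v t).1 (1 : ℂ) * p k * r) =
      ∑ f : Fin n → κ, piKronecker (fun t => Q (f t)) *
        (piKronecker fun t => single (v t).2 (v t).1 (1 : ℂ)) *
        (piKronecker fun t => p (f t)) * R := fun v => by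
    simp only [hR, piKronecker_sum, piKronecker_mul]
  simp only [hsum]
  conv_lhs => rw [hY, eq_sum_smul_piKronecker_single Y]
  simp only [Matrix.mul_sum, Matrix.sum_mul, Matrix.mul_smul, Matrix.smul_mul,
    Finset.smul_sum]
  exact Finset.sum_comm

theorem Matrix.posSemidef_choose_smul_orbitAverage_sub
    (hQh : ∀ k, (Q k).IsHermitian) (hQ : ∀ k, Q k * Q k = Q k)
    (hQQ : ∀ j k, j ≠ k → Q j * Q k = 0) (hph : ∀ k, (p k).IsHermitian)
    (hp : ∀ k, p k * p k = p k) (hpp : ∀ j k, j ≠ k → p j * p k = 0)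
    {X : Matrix C a ℂ} (hX : X = ∑ k, Q k * X * p k)
    {Y : Matrix (Fin n → C) (Fin n → a) ℂ}
    (hY : Y = ∑ f : Fin n → κ, piKronecker (fun t => Q (f t)) * Y * piKronecker fun t => p (f t))
    (hYperm : ∀ (π : Equiv.Perm (Fin n)) v w, Y (v ∘ π) (w ∘ π) = Y v w)
    (hXY : Yᴴ * Y = piKronecker fun _ => Xᴴ * X)
    {ν : Measure (Matrix C C ℂ)} [IsProbabilityMeasure ν]
    (hae : ∀ᵐ U ∂ν, U ∈ unitary (Matrix C C ℂ) ∧ ∀ k, Commute (Q k) U)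
    (hinv : ∀ V ∈ unitary (Matrix C C ℂ), (∀ k, Commute (Q k) V) →
      ν.map (fun U => V * U) = ν) {g : ℕ}
    (hg : (n + (∑ k, (p k)ᵀ ⊗ₖ Q k).rank - 1).choose n ≤ g) :
    ((g : ℂ) • orbitAverage n ν X - vecMulVec (vecPi Y) (star (vecPi Y))).PosSemidef := by
  have hQX := fun k => mul_eq_mul_of_eq_sum hQ hQQ hp hpp hX k
  have hXQ : ∀ k, Xᴴ * Q k = p k * Xᴴ := by
    intro k
    have := congrArg conjTranspose (hQX k)
    rwa [conjTranspose_mul, conjTranspose_mul, (hQh k).eq, (hph k).eq] at this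
  obtain ⟨S, hSh, hS, hSc⟩ := (isHermitian_conjTranspose_mul_self X).exists_inner_inverse
  set s := Xᴴ * X with hs
  have hSp : ∀ k, Commute S (p k) := fun k => hSc _ <| by
    rw [commute_iff_eq, hs, Matrix.mul_assoc, ← hQX, ← Matrix.mul_assoc, hXQ, Matrix.mul_assoc]
  let R : Matrix (Fin n → a) (Fin n → C) ℂ := piKronecker fun _ => S * Xᴴ
  let Xn : Matrix (Fin n → C) (Fin n → a) ℂ := piKronecker fun _ => X
  let sn : Matrix (Fin n → a) (Fin n → a) ℂ := piKronecker fun _ => s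
  let e : Matrix (Fin n → a) (Fin n → a) ℂ := piKronecker fun _ => S * s
  have hRX : R * Xn = e := by
    simp only [R, Xn, e, piKronecker_mul, hs, Matrix.mul_assoc]
  have hsne : sn * e = sn := by
    simp only [sn, e, piKronecker_mul, ← Matrix.mul_assoc, hS]
  have hYe : Y * e = Y := by
    have : (Y - Y * e)ᴴ * (Y - Y * e) = 0 := by
      have h1 : Yᴴ * (Y - Y * e) = 0 := by
        rw [Matrix.mul_sub, ← Matrix.mul_assoc, hXY, sub_eq_zero]
        exact hsne.symm
      rw [conjTranspose_sub, conjTranspose_mul, Matrix.sub_mul, Matrix.mul_assoc, h1,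
        Matrix.mul_zero, sub_zero]
    exact (sub_eq_zero.mp (conjTranspose_mul_self_eq_zero.mp this)).symm
  have hYY : ((Y * R)ᴴ * (Y * R)) * ((Y * R)ᴴ * (Y * R)) = (Y * R)ᴴ * (Y * R) := by
    have h1 : (Y * R)ᴴ * (Y * R) = piKronecker fun _ => X * S * s * S * Xᴴ := by
      rw [conjTranspose_mul, Matrix.mul_assoc, ← Matrix.mul_assoc Yᴴ, hXY]
      simp only [R, piKronecker_conjTranspose, piKronecker_mul, conjTranspose_mul,
        conjTranspose_conjTranspose, hSh.eq, Matrix.mul_assoc]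
    rw [h1, piKronecker_mul]
    congr 1
    funext _
    calc X * S * s * S * Xᴴ * (X * S * s * S * Xᴴ)
        = X * S * (s * S * s * S * s) * S * Xᴴ := by simp only [hs, Matrix.mul_assoc]
      _ = X * S * s * S * Xᴴ := by rw [hS, hS]
  have hYR := mul_piKronecker_eq_sum (R := R) hY rfl
  have hm : ∀ (d : a × C) (j : κ),
      Commute (Q j) (∑ k, Q k * single d.2 d.1 (1 : ℂ) * p k * (S * Xᴴ)) := fun d j => by
    have hSX : S * (p j * Xᴴ) = p j * (S * Xᴴ) := by
      rw [← Matrix.mul_assoc, (hSp j).eq, Matrix.mul_assoc]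
    rw [commute_iff_eq, Matrix.mul_sum, Matrix.sum_mul, Finset.sum_eq_single j,
      Finset.sum_eq_single j]
    · simp only [Matrix.mul_assoc, hXQ]
      rw [hSX, ← Matrix.mul_assoc (p j) (p j), hp, ← Matrix.mul_assoc (Q j), hQ]
    · intro k _ hk
      simp only [Matrix.mul_assoc, hXQ]
      rw [hSX, ← Matrix.mul_assoc (p k) (p j), hpp k j hk]
      simp
    · simp
    · intro k _ hk
      simp only [← Matrix.mul_assoc, hQQ j k hk.symm, Matrix.zero_mul]
    · simp
  have hT : ∀ U ∈ unitary (Matrix C C ℂ), (∀ k, Commute (Q k) U) →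
      Commute (orbitAverage n ν X) (actRight a (piKronecker fun _ => U)) :=
    fun U hU hQU => commute_orbitAverage hae hinv X U hU hQU
  have hcomm : Commute (orbitAverage n ν X) (actRight a (Y * R)) := by
    rw [hYR]
    exact commute_actRight_sum_smul Q hQh (orbitAverage n ν X) hT _ hm (vecPi Y)
      fun π v => hYperm π (fun t => (v t).2) (fun t => (v t).1)
  have hvec : vecPi Y = actRight a (Y * R) *ᵥ powVec n X := by
    have h : Y * R * Xn = Y := by rw [Matrix.mul_assoc, hRX, hYe]
    rw [powVec, actRight_mulVec_vecPi]
    exact congrArg vecPi h.symm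
  rw [hvec]
  refine PosSemidef.natCast_smul_sub_vecMulVec
    (Measure.posSemidef_secondMoment (integrable_vecMulVec_powVec hae X)) hcomm ?_
    (fun Z hZ => dotProduct_powVec_eq_trace hae hinv X Z hZ)
    ((rank_orbitAverage_le hae X (∑ k, (p k)ᵀ ⊗ₖ Q k) fun U hU =>
      piKronecker_sum_kronecker_mulVec_powVec (eq_sum_mul_of_commute hU hX)).trans hg)
  rw [← actRight_conjTranspose, ← actRight_mul, ← actRight_mul, hYY]

end Blocks

section Unfold

variable {A B R : Type*} {n : ℕ}

/-- Move the second tensor factor of the row index of a matrix to the column index, and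
transpose. -/
def Matrix.unfold (κ : Matrix (A × B) R ℂ) : Matrix (B × R) A ℂ :=
  Matrix.of fun c x => κ (x, c.1) c.2

/-- The analogue of `Matrix.unfold` for matrices on `n` systems. -/
def Matrix.unfoldPi (K : Matrix (Fin n → A × B) (Fin n → R) ℂ) :
    Matrix (Fin n → B × R) (Fin n → A) ℂ :=
  Matrix.of fun c x => K (fun t => (x t, (c t).1)) fun t => (c t).2

theorem Matrix.unfoldPi_eq_submatrix (K : Matrix (Fin n → A × B) (Fin n → R) ℂ) :
    unfoldPi K = (unfold (K.submatrix
      (Equiv.arrowProdEquivProdArrow (Fin n) (fun _ => A) (fun _ => B)).symm id)).submatrix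
        (Equiv.arrowProdEquivProdArrow (Fin n) (fun _ => B) (fun _ => R)) (Equiv.refl _) := rfl

variable [Fintype A] [Fintype B] [Fintype R]

theorem Matrix.kronecker_mul_unfold_mul (P : Matrix A A ℂ) (M : Matrix B B ℂ) (N : Matrix R R ℂ)
    (κ : Matrix (A × B) R ℂ) : (M ⊗ₖ Nᵀ) * unfold κ * Pᵀ = unfold ((P ⊗ₖ M) * κ * N) := by
  ext ⟨b, r⟩ x
  simp only [unfold, Matrix.mul_apply, of_apply, kroneckerMap_apply, transpose_apply,
    Fintype.sum_prod_type, Finset.sum_mul]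
  rw [Finset.sum_comm (s := (Finset.univ : Finset R))]
  refine Finset.sum_congr rfl fun x' _ => ?_
  rw [Finset.sum_comm (s := (Finset.univ : Finset R))]
  exact Finset.sum_congr rfl fun b' _ => Finset.sum_congr rfl fun r' _ => by ring

theorem Matrix.piKronecker_mul_unfoldPi_mul (P : Fin n → Matrix A A ℂ) (M : Fin n → Matrix B B ℂ)
    (N : Fin n → Matrix R R ℂ) (K : Matrix (Fin n → A × B) (Fin n → R) ℂ) :
    (piKronecker fun t => M t ⊗ₖ (N t)ᵀ) * unfoldPi K * (piKronecker fun t => (P t)ᵀ) =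
      unfoldPi ((piKronecker fun t => P t ⊗ₖ M t) * K * piKronecker N) := by
  rw [unfoldPi_eq_submatrix, unfoldPi_eq_submatrix, piKronecker_kronecker, piKronecker_kronecker,
    ← piKronecker_transpose, ← piKronecker_transpose]
  set e := Equiv.arrowProdEquivProdArrow (Fin n) (fun _ => A) (fun _ => B)
  have h := kronecker_mul_unfold_mul (piKronecker P) (piKronecker M) (piKronecker N)
    (K.submatrix e.symm id)
  have h2 : (((piKronecker P ⊗ₖ piKronecker M).submatrix e e * K) * piKronecker N).submatrix
      e.symm id = (piKronecker P ⊗ₖ piKronecker M) * K.submatrix e.symm id * piKronecker N := by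
    rw [← submatrix_mul_equiv _ _ _ (Equiv.refl _), ← submatrix_mul_equiv _ _ _ e.symm]
    simp
  rw [h2, ← h, ← submatrix_mul_equiv _ _ _ (Equiv.refl _),
    ← submatrix_mul_equiv _ _ _ (Equiv.arrowProdEquivProdArrow (Fin n) (fun _ => B) (fun _ => R))]
  rfl

omit [Fintype A] in
theorem Matrix.unfold_conjTranspose_mul_self (κ : Matrix (A × B) R ℂ) :
    (unfold κ)ᴴ * unfold κ = (ptrace (κ * κᴴ))ᵀ := by
  ext x y
  simp only [unfold, ptrace, Matrix.mul_apply, of_apply, conjTranspose_apply, transpose_apply,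
    Fintype.sum_prod_type]
  exact Finset.sum_congr rfl fun b _ => Finset.sum_congr rfl fun r _ => mul_comm _ _

omit [Fintype A] in
theorem Matrix.unfoldPi_conjTranspose_mul_self [DecidableEq B]
    (K : Matrix (Fin n → A × B) (Fin n → R) ℂ) :
    (unfoldPi K)ᴴ * unfoldPi K = (ptraceN (K * Kᴴ))ᵀ := by
  ext x y
  simp only [unfoldPi, ptraceN, Matrix.mul_apply, of_apply, conjTranspose_apply, transpose_apply]
  rw [← (Equiv.arrowProdEquivProdArrow (Fin n) (fun _ => B) (fun _ => R)).symm.sum_comp,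
    Fintype.sum_prod_type]
  exact Finset.sum_congr rfl fun b _ => Finset.sum_congr rfl fun r _ => mul_comm _ _

end Unfold

section Pinching

variable {C a κ : Type*} [Fintype C] [Fintype a] [Fintype κ] {p : κ → Matrix a a ℂ}
  {Q : κ → Matrix C C ℂ}

theorem Matrix.conjTranspose_mul_self_eq_sum
    (hQh : ∀ k, (Q k).IsHermitian) (hQ : ∀ k, Q k * Q k = Q k)
    (hQQ : ∀ j k, j ≠ k → Q j * Q k = 0) (hph : ∀ k, (p k).IsHermitian)
    (hp : ∀ k, p k * p k = p k) (hpp : ∀ j k, j ≠ k → p j * p k = 0)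
    {X : Matrix C a ℂ} (hX : X = ∑ k, Q k * X * p k) :
    Xᴴ * X = ∑ k, p k * (Xᴴ * X) * p k := by
  have h1 : ∀ k, Xᴴ * Q k = p k * Xᴴ := by
    intro k
    have := congrArg conjTranspose (mul_eq_mul_of_eq_sum hQ hQQ hp hpp hX k)
    rwa [conjTranspose_mul, conjTranspose_mul, (hQh k).eq, (hph k).eq] at this
  conv_lhs => enter [2]; rw [hX]
  rw [Matrix.mul_sum]
  refine Finset.sum_congr rfl fun k _ => ?_
  rw [← Matrix.mul_assoc, ← Matrix.mul_assoc, h1, ← Matrix.mul_assoc]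

open scoped MatrixOrder Matrix.Norms.L2Operator in
/-- The square root of a positive semidefinite matrix, with its inherited symmetries. -/
theorem Matrix.PosSemidef.exists_sqrt [DecidableEq a] {M : Matrix a a ℂ} (hM : M.PosSemidef) :
    ∃ K : Matrix a a ℂ, K.IsHermitian ∧ K * K = M ∧ (∀ Z, Commute M Z → Commute K Z) ∧
      ∀ e : Equiv.Perm a, M.submatrix e e = M → K.submatrix e e = K := by
  have hM0 : 0 ≤ M := hM.nonneg
  have hK := CFC.sqrt_mul_sqrt_self M hM0
  have hKp : (CFC.sqrt M).PosSemidef := nonneg_iff_posSemidef.mp (CFC.sqrt_nonneg M)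
  refine ⟨CFC.sqrt M, hKp.isHermitian, hK, fun Z hZ => ?_, fun e he => ?_⟩
  · exact hZ.cfcₙ_nnreal _
  · refine (CFC.sqrt_unique ?_ (hKp.submatrix e).nonneg).symm
    rw [submatrix_mul_equiv, hK, he]

theorem Matrix.eq_sum_mul_mul_of_sq [DecidableEq a]
    (hp : ∀ k, p k * p k = p k) (hpp : ∀ j k, j ≠ k → p j * p k = 0) {M K : Matrix a a ℂ}
    (hM : M = ∑ k, p k * M * p k) (hKh : K.IsHermitian) (hK : K * K = M)
    (hc : ∀ Z, Commute M Z → Commute K Z) : K = ∑ k, p k * K * p k := by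
  have h1 : ∀ k, Commute K (p k) := fun k =>
    hc _ (mul_eq_mul_of_eq_sum hp hpp hp hpp hM k).symm
  have hME : M * ∑ k, p k = M := by
    conv_rhs => rw [hM]
    rw [Matrix.mul_sum]
    refine Finset.sum_congr rfl fun k _ => ?_
    rw [mul_eq_mul_of_eq_sum hp hpp hp hpp hM k, Matrix.mul_assoc, hp]
  have h2 : (K - K * ∑ k, p k)ᴴ * (K - K * ∑ k, p k) = 0 := by
    have h3 : Kᴴ * (K - K * ∑ k, p k) = 0 := by
      rw [Matrix.mul_sub, ← Matrix.mul_assoc, hKh.eq, hK, hME, sub_self]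
    rw [conjTranspose_sub, conjTranspose_mul, Matrix.sub_mul, Matrix.mul_assoc, h3,
      Matrix.mul_zero, sub_zero]
  have h3 : K = K * ∑ k, p k := sub_eq_zero.mp (conjTranspose_mul_self_eq_zero.mp h2)
  conv_lhs => rw [h3, Matrix.mul_sum]
  refine Finset.sum_congr rfl fun k _ => ?_
  rw [← (h1 k).eq, Matrix.mul_assoc, hp]

end Pinching

/-- Tensor powers are injective on positive semidefinite matrices. -/
theorem Matrix.PosSemidef.eq_of_piKronecker_eq {a : Type*} [Fintype a] {n : ℕ}
    (hn : 0 < n) {s s' : Matrix a a ℂ} (hs : s.PosSemidef) (hs' : s'.PosSemidef)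
    (h : (piKronecker fun _ : Fin n => s) = piKronecker fun _ => s') : s = s' := by
  classical
  have hdiag : ∀ x, s x x = s' x x := by
    intro x
    have h1 : s x x ^ n = s' x x ^ n := by
      simpa [piKronecker] using congrFun₂ h (fun _ => x) (fun _ => x)
    obtain ⟨h2, h3⟩ := Complex.nonneg_iff.mp (hs.diag_nonneg (i := x))
    obtain ⟨h4, h5⟩ := Complex.nonneg_iff.mp (hs'.diag_nonneg (i := x))
    have h6 : s x x = ((s x x).re : ℂ) := Complex.ext rfl h3.symm
    have h7 : s' x x = ((s' x x).re : ℂ) := Complex.ext rfl h5.symm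
    rw [h6, h7] at h1 ⊢
    exact_mod_cast (pow_left_inj₀ h2 h4 hn.ne').mp (by exact_mod_cast h1)
  by_cases h0 : ∃ x0, s x0 x0 ≠ 0
  · obtain ⟨x0, hx0⟩ := h0
    obtain ⟨m, rfl⟩ : ∃ m, n = m + 1 := ⟨n - 1, by omega⟩
    ext x y
    have := congrFun₂ h (Fin.cons x fun _ => x0) (Fin.cons y fun _ => x0)
    simp only [piKronecker, of_apply, Fin.prod_univ_succ, Fin.cons_zero, Fin.cons_succ,
      Finset.prod_const, ← hdiag] at this
    exact mul_right_cancel₀ (pow_ne_zero _ hx0) this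
  · push Not at h0
    rw [hs.trace_eq_zero_iff.mp (Finset.sum_eq_zero fun x _ => h0 x),
      hs'.trace_eq_zero_iff.mp (Finset.sum_eq_zero fun x _ => (hdiag x).symm.trans (h0 x))]

theorem Matrix.rank_kronecker_le {a b : Type*} [Fintype a] [Fintype b]
    (M : Matrix a a ℂ) (N : Matrix b b ℂ) : (M ⊗ₖ N).rank ≤ M.rank * N.rank := by
  obtain ⟨u, u', hu⟩ := M.exists_mul_eq_of_rank
  obtain ⟨v, v', hv⟩ := N.exists_mul_eq_of_rank
  calc (M ⊗ₖ N).rank = ((u ⊗ₖ v) * (u' ⊗ₖ v')).rank := by rw [← mul_kronecker_mul, ← hu, ← hv]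
    _ ≤ (u ⊗ₖ v).rank := rank_mul_le_left _ _
    _ ≤ Fintype.card (Fin M.rank × Fin N.rank) := rank_le_card_width _
    _ = _ := by simp

theorem Matrix.rank_sum_le {a κ : Type*} [Fintype a] (s : Finset κ) (M : κ → Matrix a a ℂ) :
    (∑ k ∈ s, M k).rank ≤ ∑ k ∈ s, (M k).rank := by
  classical
  induction s using Finset.induction_on with
  | empty => simp
  | insert k s hk ih =>
    rw [Finset.sum_insert hk, Finset.sum_insert hk]
    refine le_trans ?_ (Nat.add_le_add_left ih _)
    rw [Matrix.rank, mulVecLin_add]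
    exact (Submodule.finrank_mono (LinearMap.range_add_le _ _)).trans
      (Submodule.finrank_add_le_finrank_add_finrank _ _)

/-- A family of pairwise orthogonal Hermitian projections. -/
structure Matrix.OrthProj {a ι : Type*} [Fintype a] (P : ι → Matrix a a ℂ) : Prop where
  herm : ∀ i, (P i).IsHermitian
  idem : ∀ i, P i * P i = P i
  orth : ∀ i j, i ≠ j → P i * P j = 0

namespace Matrix.OrthProj

variable {a b ι κ : Type*} [Fintype a] [Fintype b] {P : ι → Matrix a a ℂ} {P' : κ → Matrix b b ℂ}

theorem transpose (h : OrthProj P) : OrthProj fun i => (P i)ᵀ where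
  herm i := (h.herm i).transpose
  idem i := by rw [← transpose_mul, h.idem]
  orth i j hij := by rw [← transpose_mul, h.orth j i hij.symm, transpose_zero]

theorem kronecker (h : OrthProj P) (h' : OrthProj P') :
    OrthProj fun k : ι × κ => P k.1 ⊗ₖ P' k.2 where
  herm _ := by
    rw [IsHermitian, conjTranspose_kronecker, (h.herm _).eq, (h'.herm _).eq]
  idem _ := by rw [← mul_kronecker_mul, h.idem, h'.idem]
  orth k l hkl := by
    rw [← mul_kronecker_mul]
    by_cases h1 : k.1 = l.1
    · have h2 : k.2 ≠ l.2 := fun h2 => hkl (Prod.ext h1 h2)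
      rw [h'.orth _ _ h2, kronecker_zero]
    · rw [h.orth _ _ h1, zero_kronecker]

theorem comp (h : OrthProj P) {e : κ → ι} (he : Function.Injective e) :
    OrthProj fun k => P (e k) where
  herm _ := h.herm _
  idem _ := h.idem _
  orth _ _ hkl := h.orth _ _ (he.ne hkl)

theorem sum_snd [Fintype κ] {P : ι × κ → Matrix a a ℂ} (h : OrthProj P) :
    OrthProj fun i => ∑ j, P (i, j) where
  herm i := by
    rw [IsHermitian, conjTranspose_sum]
    exact Finset.sum_congr rfl fun j _ => (h.herm _).eq
  idem i := by
    rw [Finset.sum_mul]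
    refine Finset.sum_congr rfl fun j _ => ?_
    rw [Finset.mul_sum, Finset.sum_eq_single j, h.idem]
    · exact fun k _ hk => h.orth _ _ fun h' => hk (Prod.ext_iff.mp h').2.symm
    · simp
  orth i j hij := by
    rw [Finset.sum_mul]
    refine Finset.sum_eq_zero fun k _ => ?_
    rw [Finset.mul_sum]
    exact Finset.sum_eq_zero fun l _ => h.orth _ _ fun h' => hij (Prod.ext_iff.mp h').1

theorem pi (h : OrthProj P) (n : ℕ) :
    OrthProj fun f : Fin n → ι => piKronecker fun t => P (f t) where
  herm f := by
    rw [IsHermitian, piKronecker_conjTranspose]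
    exact congrArg piKronecker (funext fun t => (h.herm _).eq)
  idem f := by
    rw [piKronecker_mul]
    exact congrArg piKronecker (funext fun t => h.idem _)
  orth f g hfg := by
    obtain ⟨t, ht⟩ := Function.ne_iff.mp hfg
    rw [piKronecker_mul]
    exact piKronecker_eq_zero _ t (h.orth _ _ ht)

end Matrix.OrthProj

section Refold

variable {A B R ι κ : Type*} {n : ℕ}

/-- The inverse of `Matrix.unfold`. -/
def Matrix.refold (X : Matrix (B × R) A ℂ) : Matrix (A × B) R ℂ :=
  Matrix.of fun x r => X (x.2, r) x.1

theorem Matrix.unfold_refold (X : Matrix (B × R) A ℂ) : unfold (refold X) = X := rfl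

theorem Matrix.unfold_sum [Fintype ι] (K : ι → Matrix (A × B) R ℂ) :
    unfold (∑ i, K i) = ∑ i, unfold (K i) := by
  ext c x
  simp [unfold, Matrix.sum_apply]

theorem Matrix.unfoldPi_sum [Fintype ι] (K : ι → Matrix (Fin n → A × B) (Fin n → R) ℂ) :
    unfoldPi (∑ i, K i) = ∑ i, unfoldPi (K i) := by
  ext c x
  simp [unfoldPi, Matrix.sum_apply]

/-- Complete the systems of `A × B` by a configuration of the systems `R`. -/
def completeConfig (z : Fin n → R) (v : Fin n → A × B) : Fin n → A × (B × R) :=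
  fun t => ((v t).1, ((v t).2, z t))

theorem Matrix.mul_conjTranspose_eq_sum_submatrix [Fintype R] [DecidableEq R]
    (K : Matrix (Fin n → A × B) (Fin n → R) ℂ) :
    K * Kᴴ = ∑ z : Fin n → R, (vecMulVec (vecPi (unfoldPi K))
      (star (vecPi (unfoldPi K)))).submatrix (completeConfig z) (completeConfig z) := by
  ext v w
  simp only [Matrix.mul_apply, Matrix.sum_apply, submatrix_apply, vecMulVec_apply]
  rfl

theorem Matrix.tensorPow_refold [Fintype A] [Fintype B] [Fintype R] [DecidableEq R]
    (X : Matrix (B × R) A ℂ) :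
    tensorPow (refold X * (refold X)ᴴ) n = ∑ z : Fin n → R, (vecMulVec (powVec n X)
      (star (powVec n X))).submatrix (completeConfig z) (completeConfig z) := by
  rw [tensorPow_eq_piKronecker, ← piKronecker_mul, ← piKronecker_conjTranspose,
    mul_conjTranspose_eq_sum_submatrix]
  rfl

variable [Fintype A] [Fintype B] [Fintype R]

/-- The lift to `B × (A × B)` of a projection on `A`. -/
def Matrix.liftProj [Fintype κ] (PB : κ → Matrix B B ℂ) (P : Matrix A A ℂ) :
    Matrix (B × (A × B)) (B × (A × B)) ℂ :=
  ∑ j, PB j ⊗ₖ (P ⊗ₖ PB j)ᵀ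

variable [Fintype ι] [Fintype κ] {PA : ι → Matrix A A ℂ} {PB : κ → Matrix B B ℂ}

omit [Fintype ι] in
theorem Matrix.OrthProj.liftProj (hA : OrthProj PA) (hB : OrthProj PB) :
    OrthProj fun i => liftProj PB (PA i) :=
  OrthProj.sum_snd (P := fun k : ι × κ => PB k.2 ⊗ₖ (PA k.1 ⊗ₖ PB k.2)ᵀ)
    ((hB.kronecker (hA.kronecker hB).transpose).comp (e := fun k : ι × κ => (k.2, k))
      fun _ _ h => (Prod.ext_iff.mp h).2)

theorem Matrix.sum_liftProj_mul_unfold_mul (K : Matrix (A × B) (A × B) ℂ) :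
    ∑ i, liftProj PB (PA i) * unfold K * (PA i)ᵀ =
      unfold (∑ k : ι × κ, (PA k.1 ⊗ₖ PB k.2) * K * (PA k.1 ⊗ₖ PB k.2)) := by
  simp only [unfold_sum, ← kronecker_mul_unfold_mul, Fintype.sum_prod_type, Matrix.liftProj,
    Matrix.sum_mul]

theorem Matrix.sum_liftProj_mul_unfoldPi_mul [DecidableEq ι] [DecidableEq κ]
    (K : Matrix (Fin n → A × B) (Fin n → A × B) ℂ) :
    ∑ f : Fin n → ι, (piKronecker fun t => Matrix.liftProj PB (PA (f t))) * unfoldPi K *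
        (piKronecker fun t => (PA (f t))ᵀ) =
      unfoldPi (∑ f : Fin n → ι × κ, (piKronecker fun t => PA (f t).1 ⊗ₖ PB (f t).2) * K *
        (piKronecker fun t => PA (f t).1 ⊗ₖ PB (f t).2)) := by
  rw [unfoldPi_sum, ← (Equiv.arrowProdEquivProdArrow (Fin n) (fun _ => ι)
    (fun _ => κ)).symm.sum_comp, Fintype.sum_prod_type]
  refine Finset.sum_congr rfl fun f _ => ?_
  simp only [Matrix.liftProj]
  rw [piKronecker_sum, Matrix.sum_mul, Matrix.sum_mul]
  exact Finset.sum_congr rfl fun g _ => piKronecker_mul_unfoldPi_mul (fun t => PA (f t))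
    (fun t => PB (g t)) (fun t => PA (f t) ⊗ₖ PB (g t)) K

theorem Matrix.rank_sum_liftProj_le :
    (∑ i, (PA i)ᵀᵀ ⊗ₖ Matrix.liftProj PB (PA i)).rank ≤
      ∑ i, ∑ j, (PA i).rank ^ 2 * (PB j).rank ^ 2 := by
  refine (rank_sum_le _ _).trans (Finset.sum_le_sum fun i _ => ?_)
  refine (rank_kronecker_le _ _).trans ?_
  have h : (Matrix.liftProj PB (PA i)).rank ≤ ∑ j, (PA i).rank * (PB j).rank ^ 2 := by
    refine (rank_sum_le _ _).trans (Finset.sum_le_sum fun j _ => ?_)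
    refine (rank_kronecker_le _ _).trans ?_
    rw [rank_transpose]
    calc _ ≤ (PB j).rank * ((PA i).rank * (PB j).rank) :=
          Nat.mul_le_mul_left _ (rank_kronecker_le _ _)
      _ = _ := by ring
  rw [transpose_transpose]
  refine (Nat.mul_le_mul_left _ h).trans (le_of_eq ?_)
  rw [Finset.mul_sum]
  exact Finset.sum_congr rfl fun j _ => by ring

end Refold

section Marginal

variable {A B ι κ : Type*} [Fintype A] [Fintype B] [Fintype ι] [Fintype κ]
  {PA : ι → Matrix A A ℂ} {PB : κ → Matrix B B ℂ}

omit [Fintype A] in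
theorem Matrix.ptrace_kronecker (M : Matrix A A ℂ) (N : Matrix B B ℂ) :
    ptrace (M ⊗ₖ N) = N.trace • M := by
  ext x y
  simp [ptrace, trace, Finset.mul_sum, mul_comm]

theorem Matrix.exists_ptrace_mul_conjTranspose_eq [DecidableEq A] [DecidableEq B]
    (hA : OrthProj PA) (hB : OrthProj PB) {s : Matrix A A ℂ} (hs : s.PosSemidef)
    (hsA : s = ∑ i, PA i * s * PA i) (h0 : (∃ j, PB j ≠ 0) ∨ s = 0) :
    ∃ K : Matrix (A × B) (A × B) ℂ,
      K = ∑ k : ι × κ, (PA k.1 ⊗ₖ PB k.2) * K * (PA k.1 ⊗ₖ PB k.2) ∧ ptrace (K * Kᴴ) = s := by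
  rcases h0 with ⟨j, hj⟩ | rfl
  · obtain ⟨S, hSh, hS, hSc, -⟩ := hs.exists_sqrt
    have hSA := eq_sum_mul_mul_of_sq hA.idem hA.orth hsA hSh hS hSc
    have hp : (PB j).PosSemidef := by
      have := posSemidef_conjTranspose_mul_self (PB j)
      rwa [(hB.herm j).eq, hB.idem] at this
    have ht := hp.trace_nonneg
    have ht0 : (PB j).trace ≠ 0 := fun h => hj (hp.trace_eq_zero_iff.mp h)
    obtain ⟨hre, him⟩ := Complex.nonneg_iff.mp ht
    have hre0 : ((PB j).trace.re : ℂ) = (PB j).trace := Complex.ext rfl him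
    set r : ℝ := (PB j).trace.re with hr
    have hr0 : r ≠ 0 := fun h => ht0 (by rw [← hre0, h, Complex.ofReal_zero])
    set c : ℂ := Complex.ofReal (√r)⁻¹ with hc
    have hcc : c * star c * (PB j).trace = 1 := by
      rw [← hre0, hc, Complex.star_def, Complex.conj_ofReal, ← Complex.ofReal_mul,
        ← Complex.ofReal_mul, ← mul_inv, Real.mul_self_sqrt hre, inv_mul_cancel₀ hr0,
        Complex.ofReal_one]
    refine ⟨S ⊗ₖ (c • PB j), ?_, ?_⟩
    · simp only [← mul_kronecker_mul, Fintype.sum_prod_type]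
      conv_lhs => rw [hSA]
      rw [show (∑ i, PA i * S * PA i) ⊗ₖ (c • PB j) = ∑ i, (PA i * S * PA i) ⊗ₖ (c • PB j) by
        ext
        simp [Matrix.sum_apply, Finset.sum_mul]]
      refine Finset.sum_congr rfl fun i _ => ?_
      rw [Finset.sum_eq_single j]
      · rw [Matrix.mul_smul, hB.idem, Matrix.smul_mul, hB.idem]
      · intro k _ hk
        rw [Matrix.mul_smul, hB.orth _ _ hk, smul_zero, Matrix.zero_mul, kronecker_zero]
      · simp
    · rw [conjTranspose_kronecker, ← mul_kronecker_mul, ptrace_kronecker, hSh.eq, hS,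
        conjTranspose_smul, (hB.herm j).eq, Matrix.smul_mul, Matrix.mul_smul, hB.idem, smul_smul,
        trace_smul, smul_eq_mul, hcc, one_smul]
  · exact ⟨0, by simp, by ext; simp [ptrace]⟩

end Marginal

section DeFinetti

variable {A B ι κ : Type*} [Fintype A] [Fintype B] [Fintype ι] [Fintype κ]
  [DecidableEq A] [DecidableEq B]
  {PA : ι → Matrix A A ℂ} {PB : κ → Matrix B B ℂ} {n : ℕ}

theorem Matrix.OrthProj.eq_sum_mul_conjTranspose {a ι : Type*} [Fintype a] [Fintype ι]
    {P : ι → Matrix a a ℂ} (hP : OrthProj P) {K : Matrix a a ℂ} (hK : K = ∑ i, P i * K * P i) :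
    K * Kᴴ = ∑ i, P i * (K * Kᴴ) * P i := by
  have h : Kᴴ = ∑ i, P i * Kᴴ * P i := by
    conv_lhs => rw [hK]
    simp only [conjTranspose_sum, conjTranspose_mul, (hP.herm _).eq, Matrix.mul_assoc]
  simpa using conjTranspose_mul_self_eq_sum hP.herm hP.idem hP.orth hP.herm hP.idem hP.orth h

/-- The positive semidefinite matrix whose purification is rotated by `U`. -/
def Matrix.rotatedState (X : Matrix (B × (A × B)) A ℂ)
    (U : Matrix (B × (A × B)) (B × (A × B)) ℂ) : Matrix (A × B) (A × B) ℂ :=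
  refold (U * X) * (refold (U * X))ᴴ

omit [DecidableEq A] [DecidableEq B] in
theorem Matrix.continuous_rotatedState (X : Matrix (B × (A × B)) A ℂ) :
    Continuous (rotatedState X) := by
  have h : Continuous fun U : Matrix (B × (A × B)) (B × (A × B)) ℂ => refold (U * X) :=
    continuous_matrix fun _ _ => (continuous_id.matrix_mul continuous_const).matrix_elem _ _
  exact h.matrix_mul h.matrix_conjTranspose

theorem Matrix.rotatedState_spec (hA : OrthProj PA) (hB : OrthProj PB)
    {K : Matrix (A × B) (A × B) ℂ}
    (hK : K = ∑ k : ι × κ, (PA k.1 ⊗ₖ PB k.2) * K * (PA k.1 ⊗ₖ PB k.2))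
    {U : Matrix (B × (A × B)) (B × (A × B)) ℂ} (hU : U ∈ unitary (Matrix (B × (A × B)) _ ℂ))
    (hUQ : ∀ i, Commute (liftProj PB (PA i)) U) :
    (rotatedState (unfold K) U).PosSemidef ∧
      rotatedState (unfold K) U = ∑ k : ι × κ,
        (PA k.1 ⊗ₖ PB k.2) * rotatedState (unfold K) U * (PA k.1 ⊗ₖ PB k.2) ∧
      ptrace (rotatedState (unfold K) U) = ptrace (K * Kᴴ) := by
  refine ⟨posSemidef_self_mul_conjTranspose _, ?_, ?_⟩
  · refine (hA.kronecker hB).eq_sum_mul_conjTranspose ?_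
    have h := eq_sum_mul_of_commute hUQ
      ((congrArg unfold hK).trans (sum_liftProj_mul_unfold_mul K).symm)
    have h2 := sum_liftProj_mul_unfold_mul (PA := PA) (PB := PB) (refold (U * unfold K))
    rw [unfold_refold] at h2
    exact congrArg refold (h.trans h2)
  · apply transpose_injective
    rw [rotatedState, ← unfold_conjTranspose_mul_self, ← unfold_conjTranspose_mul_self,
      unfold_refold, conjTranspose_mul, Matrix.mul_assoc, ← Matrix.mul_assoc Uᴴ,
      ← star_eq_conjTranspose U, Unitary.star_mul_self_of_mem hU, Matrix.one_mul]

theorem Matrix.exists_measure_of_blockDiag [DecidableEq ι] [DecidableEq κ] (hn : 0 < n)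
    (hA : OrthProj PA) (hB : OrthProj PB)
    {s : Matrix A A ℂ} (hs : s.PosSemidef) {ρ : Matrix (Fin n → A × B) (Fin n → A × B) ℂ}
    (hρ : ρ.PosSemidef) (hperm : PermInvariant ρ) (hmarg : ptraceN ρ = tensorPow s n)
    (hblock : ρ = ∑ f : Fin n → ι × κ, (piKronecker fun t => PA (f t).1 ⊗ₖ PB (f t).2) * ρ *
      (piKronecker fun t => PA (f t).1 ⊗ₖ PB (f t).2)) :
    ∃ μ : Measure (Matrix (A × B) (A × B) ℂ), IsProbabilityMeasure μ ∧
      (∀ᵐ σ ∂μ, σ.PosSemidef ∧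
        σ = ∑ k : ι × κ, (PA k.1 ⊗ₖ PB k.2) * σ * (PA k.1 ⊗ₖ PB k.2) ∧ ptrace σ = s) ∧
      (∀ v w, Integrable (fun σ => tensorPow σ n v w) μ) ∧
      (((n + (∑ i, ∑ j, (PA i).rank ^ 2 * (PB j).rank ^ 2) - 1).choose n : ℂ) •
          (Matrix.of fun v w => ∫ σ, tensorPow σ n v w ∂μ) - ρ).PosSemidef := by
  have hP := (hA.kronecker hB).pi n
  have hQ := hA.liftProj hB
  have hp := hA.transpose
  obtain ⟨K, hKh, hK, hKc, hKe⟩ := hρ.exists_sqrt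
  have hKP : K = ∑ f : Fin n → ι × κ, (piKronecker fun t => PA (f t).1 ⊗ₖ PB (f t).2) * K *
      (piKronecker fun t => PA (f t).1 ⊗ₖ PB (f t).2) :=
    eq_sum_mul_mul_of_sq hP.idem hP.orth hblock hKh hK hKc
  have hKK : K * Kᴴ = ρ := by rw [hKh.eq, hK]
  have hKperm : PermInvariant K := fun π v w =>
    congrFun₂ (hKe (Equiv.arrowCongr π.symm (Equiv.refl _)) (by
      ext v w; exact hperm π v w)) v w
  have hY : unfoldPi K = ∑ f : Fin n → ι, (piKronecker fun t => liftProj PB (PA (f t))) *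
      unfoldPi K * (piKronecker fun t => (PA (f t))ᵀ) := by
    rw [sum_liftProj_mul_unfoldPi_mul, ← hKP]
  have hYY : (unfoldPi K)ᴴ * unfoldPi K = piKronecker fun _ => sᵀ := by
    rw [unfoldPi_conjTranspose_mul_self, hKK, hmarg]
    rfl
  have hsA : s = ∑ i, PA i * s * PA i := by
    have h1 := conjTranspose_mul_self_eq_sum (hQ.pi n).herm (hQ.pi n).idem (hQ.pi n).orth
      (hp.pi n).herm (hp.pi n).idem (hp.pi n).orth hY
    simp only [hYY, piKronecker_mul] at h1
    rw [← piKronecker_sum (fun _ i => (PA i)ᵀ * sᵀ * (PA i)ᵀ)] at h1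
    have h2 := hs.transpose.eq_of_piKronecker_eq hn
      (posSemidef_sum _ fun i _ => by
        simpa [(hp.herm i).eq] using hs.transpose.mul_mul_conjTranspose_same (PA i)ᵀ) h1
    apply transpose_injective
    simpa only [transpose_sum, transpose_mul, Matrix.mul_assoc] using h2
  have h0 : (∃ j, PB j ≠ 0) ∨ s = 0 := by
    refine or_iff_not_imp_left.mpr fun h => ?_
    push Not at h
    have hρ0 : ρ = 0 := by
      rw [hblock]
      refine Finset.sum_eq_zero fun f _ => ?_
      rw [piKronecker_eq_zero _ ⟨0, hn⟩ (by rw [h, kronecker_zero]), Matrix.mul_zero]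
    refine hs.eq_of_piKronecker_eq hn PosSemidef.zero ?_
    rw [← tensorPow_eq_piKronecker, ← hmarg, hρ0, piKronecker_eq_zero _ ⟨0, hn⟩ rfl]
    ext
    simp [ptraceN]
  obtain ⟨K0, hK0, hK0s⟩ := exists_ptrace_mul_conjTranspose_eq hA hB hs hsA h0
  obtain ⟨ν, hν, hae, hinv⟩ := exists_invariant_measure fun i => liftProj PB (PA i)
  have hXX : (unfold K0)ᴴ * unfold K0 = sᵀ := by rw [unfold_conjTranspose_mul_self, hK0s]
  have hc := continuous_rotatedState (unfold K0)
  have hm := hc.measurable.aemeasurable (μ := ν)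
  have hT : ∀ v w, Continuous fun σ : Matrix (A × B) (A × B) ℂ => tensorPow σ n v w := by
    intro v w
    simp only [tensorPow, of_apply]
    refine continuous_finsetProd _ fun t _ => ?_
    exact (continuous_id (X := Matrix (A × B) (A × B) ℂ)).matrix_elem (v t) (w t)
  refine ⟨ν.map (rotatedState (unfold K0)), Measure.isProbabilityMeasure_map hm, ?_, ?_, ?_⟩
  · have hS := (isCompact_setOf_unitary_commute fun i => liftProj PB (PA i)).image hc
    have h : ∀ᵐ σ ∂ν.map (rotatedState (unfold K0)), σ ∈ rotatedState (unfold K0) ''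
        {U | U ∈ unitary (Matrix (B × (A × B)) _ ℂ) ∧ ∀ i, Commute (liftProj PB (PA i)) U} := by
      refine (ae_map_iff hm hS.isClosed.measurableSet).mpr ?_
      exact hae.mono fun U hU => ⟨U, hU, rfl⟩
    refine h.mono ?_
    rintro _ ⟨U, hU, rfl⟩
    have := rotatedState_spec hA hB hK0 hU.1 hU.2
    rwa [hK0s] at this
  · intro v w
    rw [integrable_map_measure (hT v w).aestronglyMeasurable hm]
    exact Measure.integrable_of_ae_unitary (hae.mono fun U hU => hU.1) ((hT v w).comp hc)
  · have h := posSemidef_choose_smul_orbitAverage_sub hQ.herm hQ.idem hQ.orth hp.herm hp.idem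
      hp.orth ((congrArg unfold hK0).trans (sum_liftProj_mul_unfold_mul K0).symm) hY
      (fun π v w => hKperm π (fun t => (w t, (v t).1)) fun t => (v t).2)
      (by rw [hYY, hXX]) hae hinv (g := (n + (∑ i, ∑ j, (PA i).rank ^ 2 * (PB j).rank ^ 2) -
        1).choose n) (Nat.choose_le_choose _ (Nat.sub_le_sub_right
          (Nat.add_le_add_left rank_sum_liftProj_le _) _))
    have h2 := posSemidef_sum Finset.univ fun (z : Fin n → A × B) _ =>
      h.submatrix (completeConfig z)
    convert h2 using 1
    simp only [submatrix_sub, Pi.sub_apply, Finset.sum_sub_distrib,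
      ← mul_conjTranspose_eq_sum_submatrix, hKK]
    congr 1
    ext v w
    simp only [Matrix.sum_apply, submatrix_apply, Matrix.smul_apply, ← Finset.smul_sum, of_apply]
    congr 1
    rw [integral_map hm (hT v w).aestronglyMeasurable]
    simp only [rotatedState, tensorPow_refold, Matrix.sum_apply, submatrix_apply]
    exact integral_finsetSum _ fun z _ => integrable_vecMulVec_powVec hae _ _ _

end DeFinetti

end BlockDiagonalDeFinetti

/-- **Corollary 2.7 (de Finetti reduction for IID-block-diagonal states with fixed
marginal).** -/
theorem deFinetti_blockDiag_fixed_marginal (n dA dB kA kB : ℕ)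
    (hn : 0 < n) (hdA : 0 < dA) (hdB : 0 < dB) (hkA : 0 < kA) (hkB : 0 < kB)
    (PA : Fin kA → Matrix (Fin dA) (Fin dA) ℂ) (PB : Fin kB → Matrix (Fin dB) (Fin dB) ℂ)
    (hhermA : ∀ i, (PA i).IsHermitian) (hprojA : ∀ i, PA i * PA i = PA i)
    (horthA : ∀ i j, i ≠ j → PA i * PA j = 0)
    (hhermB : ∀ i, (PB i).IsHermitian) (hprojB : ∀ i, PB i * PB i = PB i)
    (horthB : ∀ i j, i ≠ j → PB i * PB j = 0)
    (σhat : Matrix (Fin dA) (Fin dA) ℂ) (hσ : σhat.PosSemidef)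
    (ρ : Matrix (Fin n → Fin dA × Fin dB) (Fin n → Fin dA × Fin dB) ℂ)
    (hρ : ρ.PosSemidef) (hperm : PermInvariant ρ)
    (hmarg : ptraceN ρ = tensorPow σhat n)
    (hblock : ρ = ∑ f : Fin n → Fin kA × Fin kB,
      (tensorFam fun t => (PA (f t).1) ⊗ₖ (PB (f t).2)) * ρ *
        (tensorFam fun t => (PA (f t).1) ⊗ₖ (PB (f t).2))) :
    ∃ μ : Measure (Matrix (Fin dA × Fin dB) (Fin dA × Fin dB) ℂ), IsProbabilityMeasure μ ∧
      (∀ᵐ σ ∂μ, σ.PosSemidef ∧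
        σ = ∑ i : Fin kA, ∑ j : Fin kB, ((PA i) ⊗ₖ (PB j)) * σ * ((PA i) ⊗ₖ (PB j)) ∧
        ptrace σ = σhat) ∧
      (∀ v w, Integrable (fun σ => tensorPow σ n v w) μ) ∧
      (((n + (∑ i : Fin kA, ∑ j : Fin kB, (PA i).rank ^ 2 * (PB j).rank ^ 2) - 1).choose n : ℂ) •
          (Matrix.of fun v w => ∫ σ, tensorPow σ n v w ∂μ) - ρ).PosSemidef := by
  have h := Matrix.exists_measure_of_blockDiag hn ⟨hhermA, hprojA, horthA⟩
    ⟨hhermB, hprojB, horthB⟩ hσ hρ hperm hmarg hblock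
  simpa only [Fintype.sum_prod_type] using h

end
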